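/- Let f be a multicritical circle map with irrational rotation number and fixed critical point c₀, and set T_n = I_{n+1} ∪ I_n ∪ f^{q_n}(I_n). There exist constants K₀ = K₀(f) > 1 and n₀ = n₀(f) ∈ ℕ such that for all n ≥ n₀ the following holds. Call j ∈ {1, …, q_{n+1}} a critical time if f^j(T_n) contains a critical point of f. If 1 ≤ j₁ < j₂ ≤ q_{n+1} are two consecutive critical times, then for every x ∈ f^{j₁+1}(I_n) one has K₀^{-1} |f^{j₂}(I_n)|/|f^{j₁+1}(I_n)| ≤ Df^{j₂−j₁−1}(x) ≤ K₀ |f^{j₂}(I_n)|/|f^{j₁+1}(I_n)|. -/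

import Mathlib

open Set Filter Topology
open scoped ENNReal

noncomputable section

namespace MCircle

/-- A lift of an orientation-preserving `C³` circle homeomorphism of `S¹ = ℝ/ℤ`:
a `C³`, strictly increasing map commuting with the unit translation. -/
structure IsCircleMapLift (f : ℝ → ℝ) : Prop where
  smooth : ContDiff ℝ 3 f
  mono : StrictMono f
  periodic : ∀ x : ℝ, f (x + 1) = f x + 1

/-- `c` is a non-flat (power-law) critical point of `f` of criticality `d > 1`:
near `c` we have `f x = f c + φ x * |φ x| ^ (d - 1)` for a `C³` diffeomorphism `φ`
of a neighbourhood `W` of `c` with `φ c = 0`. -/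
def IsNonFlatCritPt (f : ℝ → ℝ) (c d : ℝ) : Prop :=
  1 < d ∧ ∃ (W : Set ℝ) (φ : ℝ → ℝ), IsOpen W ∧ c ∈ W ∧
    ContDiffOn ℝ 3 φ W ∧ φ c = 0 ∧ (∀ x ∈ W, deriv φ x ≠ 0) ∧ InjOn φ W ∧
    ∀ x ∈ W, f x = f c + φ x * |φ x| ^ (d - 1)

/-- `f` is (a lift of) a multicritical circle map: the set of critical points of the
induced circle map, represented in `[0,1)`, is the nonempty finite set `C`, and each
critical point `c ∈ C` is non-flat of criticality `dc c`. -/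
def IsMulticriticalLift (f : ℝ → ℝ) (C : Finset ℝ) (dc : ℝ → ℝ) : Prop :=
  IsCircleMapLift f ∧ C.Nonempty ∧ (↑C : Set ℝ) ⊆ Ico (0 : ℝ) 1 ∧
    (∀ x : ℝ, deriv f x = 0 ↔ ∃ c ∈ C, ∃ k : ℤ, x = c + (k : ℝ)) ∧
    ∀ c ∈ C, IsNonFlatCritPt f c (dc c)

/-- The lift `f` has (translation) rotation number `ρ`. -/
def HasRotNumber (f : ℝ → ℝ) (ρ : ℝ) : Prop :=
  Tendsto (fun n : ℕ => f^[n] 0 / (n : ℝ)) atTop (𝓝 ρ)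

/-- `f` is (a lift of) a multicritical circle map with critical set `C` (criticalities
`dc`) and irrational rotation number `ρ`, the lift being normalized so that `ρ ∈ (0,1)`. -/
def GoodMap (f : ℝ → ℝ) (C : Finset ℝ) (dc : ℝ → ℝ) (ρ : ℝ) : Prop :=
  IsMulticriticalLift f C dc ∧ HasRotNumber f ρ ∧ Irrational ρ ∧ ρ ∈ Ioo (0 : ℝ) 1

/-- The Gauss map. -/
def gaussMap (x : ℝ) : ℝ := Int.fract x⁻¹

/-- The partial quotients `aₙ` of the continued fraction expansion
`ρ = [a₀, a₁, …] = 1/(a₀ + 1/(a₁ + ⋯))`. -/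
def cfA (ρ : ℝ) (n : ℕ) : ℕ := ⌊(gaussMap^[n] (Int.fract ρ))⁻¹⌋₊

/-- The denominators `qₙ` of the convergents of `ρ` (the return times):
`q₀ = 1`, `q₁ = a₀`, `q_{n+2} = a_{n+1} q_{n+1} + qₙ`. -/
def qden (ρ : ℝ) : ℕ → ℕ
  | 0 => 1
  | 1 => cfA ρ 0
  | n + 2 => cfA ρ (n + 1) * qden ρ (n + 1) + qden ρ n

/-- The numerators `pₙ` of the convergents of `ρ`:
`p₀ = 0`, `p₁ = 1`, `p_{n+2} = a_{n+1} p_{n+1} + pₙ`. -/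
def pnum (ρ : ℝ) : ℕ → ℕ
  | 0 => 0
  | 1 => 1
  | n + 2 => cfA ρ (n + 1) * pnum ρ (n + 1) + pnum ρ n

/-- The lift representative of the `n`-th closest return `f^{qₙ}(x)`,
normalized (by the integer `pₙ`) to lie at distance less than one from `x`. -/
def retPt (f : ℝ → ℝ) (ρ x : ℝ) (n : ℕ) : ℝ := f^[qden ρ n] x - (pnum ρ n : ℝ)

/-- The arc `Iₙ(x)`, with endpoints `x` and `f^{qₙ}(x)` and containing `f^{q_{n+2}}(x)`,
realized as an interval in the lift. -/
def arcI (f : ℝ → ℝ) (ρ x : ℝ) (n : ℕ) : Set ℝ := uIcc x (retPt f ρ x n)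

/-- The length `|Iₙ(x)|`. -/
def arcLen (f : ℝ → ℝ) (ρ x : ℝ) (n : ℕ) : ℝ := |retPt f ρ x n - x|

/-- The length `|f^j(Iₙ(x))|`. -/
def arcImgLen (f : ℝ → ℝ) (ρ x : ℝ) (n j : ℕ) : ℝ :=
  |f^[j] (retPt f ρ x n) - f^[j] x|

/-- Indices for the atoms of the `n`-th dynamical partition
`𝒫ₙ(x) = {fⁱ(Iₙ(x)) : 0 ≤ i ≤ q_{n+1}-1} ∪ {f^j(I_{n+1}(x)) : 0 ≤ j ≤ qₙ-1}`. -/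
abbrev AtomIdx (ρ : ℝ) (n : ℕ) : Type :=
  {i : ℕ // i < qden ρ (n + 1)} ⊕ {j : ℕ // j < qden ρ n}

/-- Left endpoint (in the lift) of an atom of `𝒫ₙ(x)`. -/
def atomL (f : ℝ → ℝ) (ρ x : ℝ) (n : ℕ) : AtomIdx ρ n → ℝ
  | Sum.inl i => min (f^[i.1] x) (f^[i.1] (retPt f ρ x n))
  | Sum.inr j => min (f^[j.1] x) (f^[j.1] (retPt f ρ x (n + 1)))

/-- Right endpoint (in the lift) of an atom of `𝒫ₙ(x)`. -/
def atomR (f : ℝ → ℝ) (ρ x : ℝ) (n : ℕ) : AtomIdx ρ n → ℝ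
  | Sum.inl i => max (f^[i.1] x) (f^[i.1] (retPt f ρ x n))
  | Sum.inr j => max (f^[j.1] x) (f^[j.1] (retPt f ρ x (n + 1)))

/-- Length of an atom of `𝒫ₙ(x)`. -/
def atomLen (f : ℝ → ℝ) (ρ x : ℝ) (n : ℕ) (A : AtomIdx ρ n) : ℝ :=
  atomR f ρ x n A - atomL f ρ x n A

/-- Two lift points represent the same point of the circle `ℝ/ℤ`. -/
def SameCirclePt (a b : ℝ) : Prop := ∃ m : ℤ, a = b + (m : ℝ)

/-- Two atoms of `𝒫ₙ(x)` are adjacent: they are distinct and share an endpoint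
on the circle. -/
def AdjacentAtoms (f : ℝ → ℝ) (ρ x : ℝ) (n : ℕ) (A B : AtomIdx ρ n) : Prop :=
  A ≠ B ∧ ∃ p ∈ ({atomL f ρ x n A, atomR f ρ x n A} : Set ℝ),
    ∃ q ∈ ({atomL f ρ x n B, atomR f ρ x n B} : Set ℝ), SameCirclePt p q

/-- `A` is the left neighbour of `Δ` in `𝒫ₙ(x)`. -/
def IsLeftNbr (f : ℝ → ℝ) (ρ x : ℝ) (n : ℕ) (A Δ : AtomIdx ρ n) : Prop :=
  A ≠ Δ ∧ SameCirclePt (atomR f ρ x n A) (atomL f ρ x n Δ)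

/-- `B` is the right neighbour of `Δ` in `𝒫ₙ(x)`. -/
def IsRightNbr (f : ℝ → ℝ) (ρ x : ℝ) (n : ℕ) (B Δ : AtomIdx ρ n) : Prop :=
  B ≠ Δ ∧ SameCirclePt (atomL f ρ x n B) (atomR f ρ x n Δ)

/-- The arc `f^j(Δ)` is contained (as a circle arc) in some element of `𝒫ₙ(x)`. -/
def ImgInAtom (f : ℝ → ℝ) (ρ x : ℝ) (n j : ℕ) (Δ : AtomIdx ρ n) : Prop :=
  ∃ E : AtomIdx ρ n, ∃ m : ℤ,
    atomL f ρ x n E + (m : ℝ) ≤ f^[j] (atomL f ρ x n Δ) ∧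
    f^[j] (atomR f ρ x n Δ) ≤ atomR f ρ x n E + (m : ℝ)

/-- An atom of `𝒫ₙ(x)` as a subset of the circle `ℝ/ℤ`. -/
def atomSetC (f : ℝ → ℝ) (ρ x : ℝ) (n : ℕ) (A : AtomIdx ρ n) : Set (AddCircle (1 : ℝ)) :=
  (fun y : ℝ => (y : AddCircle (1 : ℝ))) '' Icc (atomL f ρ x n A) (atomR f ρ x n A)

/-- The interval `Tₙ = I_{n+1} ∪ Iₙ ∪ f^{qₙ}(Iₙ)`, realized in the lift. -/
def Tset (f : ℝ → ℝ) (ρ x : ℝ) (n : ℕ) : Set ℝ :=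
  arcI f ρ x (n + 1) ∪ arcI f ρ x n ∪
    (fun z => f^[qden ρ n] z - (pnum ρ n : ℝ)) '' arcI f ρ x n

/-- `j` is a critical time: `f^j(Tₙ)` contains a critical point of `f` (mod 1). -/
def IsCritTime (f : ℝ → ℝ) (ρ x : ℝ) (C : Finset ℝ) (n j : ℕ) : Prop :=
  ∃ c ∈ C, ∃ m : ℤ, c + (m : ℝ) ∈ f^[j] '' Tset f ρ x n

/-- The cross-ratio `[M,T] = |L||R|/(|L∪M||M∪R|)` of the configuration
`M = [b,c] ⋐ T = [a,d]` (so `L = [a,b]`, `R = [c,d]`). -/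
def crossRatio (a b c d : ℝ) : ℝ := ((b - a) * (d - c)) / ((c - a) * (d - b))

/-- The cross-ratio distortion `CrD(g; M, T)` of `g` on the configuration
`M = [b,c] ⋐ T = [a,d]`. -/
def crD (g : ℝ → ℝ) (a b c d : ℝ) : ℝ :=
  crossRatio (g a) (g b) (g c) (g d) / crossRatio a b c d

/-- The Schwarzian derivative `Sg = g'''/g' - (3/2)(g''/g')²`. -/
def schwarzian (g : ℝ → ℝ) (x : ℝ) : ℝ :=
  iteratedDeriv 3 g x / deriv g x - (3 / 2) * (iteratedDeriv 2 g x / deriv g x) ^ 2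

/-- `g` is a diffeomorphism on `S` with distortion bounded by `K`. -/
def DiffeoWithDistortionLE (g : ℝ → ℝ) (S : Set ℝ) (K : ℝ) : Prop :=
  ContDiffOn ℝ 1 g S ∧ InjOn g S ∧ (∀ x ∈ S, deriv g x ≠ 0) ∧
    ∀ x ∈ S, ∀ y ∈ S, |deriv g x| ≤ K * |deriv g y|

/-- `g` is a diffeomorphism on `S` with negative Schwarzian derivative. -/
def NegSchwarzDiffeoOn (g : ℝ → ℝ) (S : Set ℝ) : Prop :=
  ContDiffOn ℝ 3 g S ∧ InjOn g S ∧ ∀ x ∈ S, deriv g x ≠ 0 ∧ schwarzian g x < 0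

/-- The local quasi-symmetric distortion
`σ_h(x) = lim_{δ→0} limsup_{|t|≤δ} |h(x+t)-h(x)|/|h(x)-h(x-t)|` of a circle
homeomorphism lift `h`, with values in `[0,∞]`. -/
def qsDistortion (h : ℝ → ℝ) (x : ℝ) : ℝ≥0∞ :=
  Filter.limsup
    (fun t : ℝ => ENNReal.ofReal (|h (x + t) - h x| / |h x - h (x - t)|))
    (𝓝[≠] (0 : ℝ))

end MCircle

open MCircle

namespace MCircle

/-- `g` contracts the cross-ratio `|M||T| / (|L||R|)` of the configuration `a < b < c < d`
by a factor of at least `θ`. -/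
def CrossBound (g : ℝ → ℝ) (θ a b c d : ℝ) : Prop :=
  θ * ((g b - g a) * (g d - g c) * ((c - b) * (d - a))) ≤
    (g c - g b) * (g d - g a) * ((b - a) * (d - c))

theorem sinh_mul_sinh_le {s x y : ℝ} (hs : 1 ≤ s) (hx : 0 ≤ x) (hxy : x ≤ y) :
    Real.sinh (s * x) * Real.sinh y ≤ Real.sinh (s * y) * Real.sinh x := by
  -- `s cosh (s t) sinh t - sinh (s t) cosh t ≥ 0`
  have key : ∀ t : ℝ, 0 ≤ t →
      0 ≤ s * Real.cosh (s * t) * Real.sinh t - Real.sinh (s * t) * Real.cosh t := by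
    have hm : MonotoneOn (fun t : ℝ =>
        s * Real.cosh (s * t) * Real.sinh t - Real.sinh (s * t) * Real.cosh t) (Ici 0) := by
      have hd : ∀ t : ℝ, HasDerivAt (fun t : ℝ =>
          s * Real.cosh (s * t) * Real.sinh t - Real.sinh (s * t) * Real.cosh t)
          ((s ^ 2 - 1) * (Real.sinh (s * t) * Real.sinh t)) t := by
        intro t
        have h1 : HasDerivAt (fun t : ℝ => s * t) s t := by
          simpa using (hasDerivAt_id t).const_mul s
        have h2 := ((h1.cosh.const_mul s).mul (Real.hasDerivAt_sinh t)).sub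
          (h1.sinh.mul (Real.hasDerivAt_cosh t))
        exact h2.congr_deriv (by ring)
      refine monotoneOn_of_deriv_nonneg (convex_Ici 0)
        (fun t _ => (hd t).continuousAt.continuousWithinAt)
        (fun t _ => (hd t).differentiableAt.differentiableWithinAt) ?_
      intro t ht
      rw [interior_Ici] at ht
      rw [(hd t).deriv]
      have ht0 : 0 < t := ht
      have h1 : 0 ≤ Real.sinh t := Real.sinh_nonneg_iff.2 ht0.le
      have h2 : 0 ≤ Real.sinh (s * t) := Real.sinh_nonneg_iff.2 (by positivity)
      have h3 : 0 ≤ s ^ 2 - 1 := by nlinarith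
      positivity
    intro t ht
    have := hm (show (0 : ℝ) ∈ Ici 0 from mem_Ici.2 le_rfl) (show t ∈ Ici (0 : ℝ) from ht) ht
    simpa using this
  rcases hx.eq_or_lt with rfl | hx0
  · simp
  have hmono : MonotoneOn (fun t : ℝ => Real.sinh (s * t) / Real.sinh t) (Ioi 0) := by
    have hd : ∀ t : ℝ, 0 < t → HasDerivAt (fun t : ℝ => Real.sinh (s * t) / Real.sinh t)
        ((s * Real.cosh (s * t) * Real.sinh t - Real.sinh (s * t) * Real.cosh t)
          / Real.sinh t ^ 2) t := by
      intro t ht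
      have h1 : HasDerivAt (fun t : ℝ => s * t) s t := by
        simpa using (hasDerivAt_id t).const_mul s
      have h2 := h1.sinh.div (Real.hasDerivAt_sinh t) (Real.sinh_pos_iff.2 ht).ne'
      exact h2.congr_deriv (by ring)
    refine monotoneOn_of_deriv_nonneg (convex_Ioi 0)
      (fun t ht => (hd t ht).continuousAt.continuousWithinAt)
      (fun t ht => (hd t (by simpa using ht)).differentiableAt.differentiableWithinAt) ?_
    intro t ht
    rw [interior_Ioi] at ht
    rw [(hd t ht).deriv]
    exact div_nonneg (key t (le_of_lt ht)) (sq_nonneg _)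
  have := hmono (show x ∈ Ioi (0 : ℝ) from hx0)
    (show y ∈ Ioi (0 : ℝ) from hx0.trans_le hxy) hxy
  have h1 : 0 < Real.sinh x := Real.sinh_pos_iff.2 hx0
  have h2 : 0 < Real.sinh y := Real.sinh_pos_iff.2 (hx0.trans_le hxy)
  rwa [div_le_div_iff₀ h1 h2] at this

theorem exp_sub_exp (u v : ℝ) :
    Real.exp u - Real.exp v = 2 * Real.exp ((u + v) / 2) * Real.sinh ((u - v) / 2) := by
  rw [Real.sinh_eq]
  have h1 : Real.exp u = Real.exp ((u + v) / 2) * Real.exp ((u - v) / 2) := by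
    rw [← Real.exp_add]; congr 1; ring
  have h2 : Real.exp v = Real.exp ((u + v) / 2) * Real.exp (-((u - v) / 2)) := by
    rw [← Real.exp_add]; congr 1; ring
  rw [h1, h2]; ring

theorem exp_cross_le {s α β γ δ : ℝ} (hs : 1 ≤ s) (h1 : α < β) (h2 : β < γ) (h3 : γ < δ) :
    (Real.exp (s * β) - Real.exp (s * α)) * (Real.exp (s * δ) - Real.exp (s * γ)) *
        ((Real.exp γ - Real.exp α) * (Real.exp δ - Real.exp β)) ≤
      (Real.exp (s * γ) - Real.exp (s * α)) * (Real.exp (s * δ) - Real.exp (s * β)) *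
        ((Real.exp β - Real.exp α) * (Real.exp δ - Real.exp γ)) := by
  set E := Real.exp (s * (α + β + γ + δ) / 2) * Real.exp ((α + β + γ + δ) / 2) with hE
  have hE0 : 0 < E := by positivity
  have e1 : Real.exp ((s * β + s * α) / 2) * Real.exp ((s * δ + s * γ) / 2) *
      (Real.exp ((γ + α) / 2) * Real.exp ((δ + β) / 2)) = E := by
    rw [hE]; simp only [← Real.exp_add]; congr 1; ring
  have e2 : Real.exp ((s * γ + s * α) / 2) * Real.exp ((s * δ + s * β) / 2) *
      (Real.exp ((β + α) / 2) * Real.exp ((δ + γ) / 2)) = E := by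
    rw [hE]; simp only [← Real.exp_add]; congr 1; ring
  have i1 := sinh_mul_sinh_le (x := (β - α) / 2) (y := (γ - α) / 2) hs (by linarith) (by linarith)
  have i2 := sinh_mul_sinh_le (x := (δ - γ) / 2) (y := (δ - β) / 2) hs (by linarith) (by linarith)
  have n1 : 0 ≤ Real.sinh (s * ((δ - γ) / 2)) * Real.sinh ((δ - β) / 2) :=
    mul_nonneg (Real.sinh_nonneg_iff.2 (by apply mul_nonneg <;> linarith))
      (Real.sinh_nonneg_iff.2 (by linarith))
  have n2 : 0 ≤ Real.sinh (s * ((γ - α) / 2)) * Real.sinh ((β - α) / 2) :=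
    mul_nonneg (Real.sinh_nonneg_iff.2 (by apply mul_nonneg <;> linarith))
      (Real.sinh_nonneg_iff.2 (by linarith))
  have i3 := mul_le_mul i1 i2 n1 n2
  simp only [exp_sub_exp]
  have r : ∀ u v : ℝ, (s * u - s * v) / 2 = s * ((u - v) / 2) := fun u v => by ring
  simp only [r]
  calc _ = 16 * E * ((Real.sinh (s * ((β - α) / 2)) * Real.sinh ((γ - α) / 2)) *
        (Real.sinh (s * ((δ - γ) / 2)) * Real.sinh ((δ - β) / 2))) := by rw [← e1]; ring
    _ ≤ 16 * E * ((Real.sinh (s * ((γ - α) / 2)) * Real.sinh ((β - α) / 2)) *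
        (Real.sinh (s * ((δ - β) / 2)) * Real.sinh ((δ - γ) / 2))) := by gcongr
    _ = _ := by rw [← e2]; ring

theorem rpow_crossBound {s a b c d : ℝ} (hs : 1 ≤ s) (ha : 0 < a) (h1 : a < b) (h2 : b < c)
    (h3 : c < d) : CrossBound (fun x => x ^ s) 1 a b c d := by
  have hb := ha.trans h1
  have hc := hb.trans h2
  have hd := hc.trans h3
  have := exp_cross_le hs (Real.log_lt_log ha h1) (Real.log_lt_log hb h2) (Real.log_lt_log hc h3)
  have e : ∀ x : ℝ, 0 < x → x ^ s = Real.exp (s * Real.log x) := fun x hx => by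
    rw [Real.rpow_def_of_pos hx, mul_comm]
  simp only [← e _ ha, ← e _ hb, ← e _ hc, ← e _ hd, Real.exp_log ha, Real.exp_log hb,
    Real.exp_log hc, Real.exp_log hd] at this
  unfold CrossBound
  linarith

/-- The odd power map. -/
def oddPow (s y : ℝ) : ℝ := y * |y| ^ (s - 1)

theorem oddPow_of_pos {s y : ℝ} (hy : 0 < y) : oddPow s y = y ^ s := by
  rw [oddPow, abs_of_pos hy, Real.rpow_sub_one hy.ne']
  field_simp

theorem oddPow_neg (s y : ℝ) : oddPow s (-y) = -oddPow s y := by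
  simp [oddPow]

theorem oddPow_zero (s : ℝ) : oddPow s 0 = 0 := by simp [oddPow]

theorem abs_oddPow {s y : ℝ} (hs : 1 < s) : |oddPow s y| = |y| ^ s := by
  rcases lt_trichotomy y 0 with h | h | h
  · have : oddPow s y = - oddPow s (-y) := by rw [oddPow_neg]; ring
    rw [this, abs_neg, oddPow_of_pos (by linarith : 0 < -y), abs_of_neg h,
      abs_of_nonneg (Real.rpow_nonneg (by linarith) _)]
  · subst h; rw [oddPow_zero, abs_zero, Real.zero_rpow (by linarith)]
  · rw [oddPow_of_pos h, abs_of_pos h, abs_of_nonneg (Real.rpow_nonneg h.le _)]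

theorem oddPow_strictMono {s : ℝ} (hs : 1 < s) : StrictMono (oddPow s) := by
  have hpos : ∀ x y : ℝ, 0 ≤ x → x < y → oddPow s x < oddPow s y := by
    intro x y hx hxy
    rcases hx.eq_or_lt with rfl | hx
    · rw [oddPow_zero, oddPow_of_pos hxy]; positivity
    · rw [oddPow_of_pos hx, oddPow_of_pos (hx.trans hxy)]
      exact Real.rpow_lt_rpow hx.le hxy (by linarith)
  have hneg : ∀ x y : ℝ, y ≤ 0 → x < y → oddPow s x < oddPow s y := by
    intro x y hy hxy
    have := hpos (-y) (-x) (by linarith) (by linarith)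
    rw [oddPow_neg, oddPow_neg] at this
    linarith
  intro x y hxy
  rcases le_total 0 x with h | h
  · exact hpos x y h hxy
  rcases le_total y 0 with h' | h'
  · exact hneg x y h' hxy
  · rcases h.eq_or_lt with rfl | h
    · exact hpos _ _ le_rfl hxy
    · have h1 := hneg x 0 le_rfl h
      rcases h'.eq_or_lt with rfl | h'
      · exact h1
      · exact h1.trans (hpos 0 y le_rfl h')

theorem oddPow_crossBound {s a b c d : ℝ} (hs : 1 ≤ s) (h1 : a < b) (h2 : b < c)
    (h3 : c < d) (h0 : 0 < a ∨ d < 0) : CrossBound (oddPow s) 1 a b c d := by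
  rcases h0 with h0 | h0
  · have := rpow_crossBound hs h0 h1 h2 h3
    simp only [CrossBound] at this ⊢
    rwa [oddPow_of_pos h0, oddPow_of_pos (h0.trans h1), oddPow_of_pos (h0.trans (h1.trans h2)),
      oddPow_of_pos (h0.trans (h1.trans (h2.trans h3)))]
  · have := rpow_crossBound hs (a := -d) (b := -c) (c := -b) (d := -a) (by linarith)
      (by linarith) (by linarith) (by linarith)
    simp only [CrossBound] at this ⊢
    rw [← oddPow_of_pos (by linarith : 0 < -a), ← oddPow_of_pos (by linarith : 0 < -b),
      ← oddPow_of_pos (by linarith : 0 < -c), ← oddPow_of_pos (by linarith : 0 < -d)] at this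
    simp only [oddPow_neg] at this
    linarith

theorem hasDerivAt_oddPow {s y : ℝ} (hy : y ≠ 0) :
    HasDerivAt (oddPow s) (s * |y| ^ (s - 1)) y := by
  have hpos : ∀ y : ℝ, 0 < y → HasDerivAt (oddPow s) (s * |y| ^ (s - 1)) y := by
    intro y hy
    have h := Real.hasDerivAt_rpow_const (x := y) (p := s) (Or.inl hy.ne')
    rw [abs_of_pos hy]
    refine h.congr_of_eventuallyEq ?_
    filter_upwards [lt_mem_nhds hy] with t ht using oddPow_of_pos ht
  rcases lt_or_gt_of_ne hy with h | h
  · have h1 := hpos (-y) (by linarith)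
    have h2 : HasDerivAt (fun t : ℝ => - oddPow s (-t)) (s * |-y| ^ (s - 1)) y := by
      exact (h1.comp y (hasDerivAt_neg y)).neg.congr_deriv (by ring)
    rw [abs_neg] at h2
    refine h2.congr_of_eventuallyEq (Eventually.of_forall fun t => ?_)
    simp [oddPow_neg]
  · exact hpos y h

/-- The derivative of the odd power map is dominated by its difference quotients. -/
theorem oddPow_deriv_le {s : ℝ} (hs : 1 < s) {u v : ℝ} (huv : u < v) :
    s * |u| ^ (s - 1) * (v - u) ≤ 2 * s * (oddPow s v - oddPow s u) ∧
    s * |v| ^ (s - 1) * (v - u) ≤ 2 * s * (oddPow s v - oddPow s u) := by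
  have hs0 : 0 < s := by linarith
  -- first endpoint
  have key : ∀ u v : ℝ, u < v →
      |u| ^ (s - 1) * (v - u) ≤ 2 * (oddPow s v - oddPow s u) := by
    intro u v huv
    have hm := oddPow_strictMono hs
    rcases le_or_gt 0 u with h | h
    · rw [abs_of_nonneg h]
      have hv : 0 < v := h.trans_lt huv
      have e1 : oddPow s v = v * v ^ (s - 1) := by simp [oddPow, abs_of_pos hv]
      have e2 : oddPow s u = u * u ^ (s - 1) := by simp [oddPow, abs_of_nonneg h]
      have h3 : u ^ (s - 1) ≤ v ^ (s - 1) := Real.rpow_le_rpow h huv.le (by linarith)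
      have h4 : 0 ≤ u ^ (s - 1) := Real.rpow_nonneg h _
      rw [e1, e2]
      nlinarith [mul_le_mul_of_nonneg_left h3 hv.le]
    · set w := -u with hw
      have hw0 : 0 < w := by linarith
      have hu : u = -w := by linarith
      have e2 : oddPow s u = -(w * w ^ (s - 1)) := by
        rw [hu, oddPow_neg]; simp [oddPow, abs_of_pos hw0]
      have e3 : |u| = w := by rw [abs_of_neg h]
      have h4 : 0 < w ^ (s - 1) := Real.rpow_pos_of_pos hw0 _
      rw [e2, e3]
      rcases le_or_gt v 0 with hv | hv
      · have e1 : oddPow s v = v * (-v) ^ (s - 1) := by simp [oddPow, abs_of_nonpos hv]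
        have h3 : (-v) ^ (s - 1) ≤ w ^ (s - 1) :=
          Real.rpow_le_rpow (by linarith) (by linarith) (by linarith)
        rw [e1]
        nlinarith [mul_le_mul_of_nonneg_left h3 (by linarith : 0 ≤ -v), mul_pos hw0 h4]
      · have e1 : oddPow s v = v * v ^ (s - 1) := by simp [oddPow, abs_of_pos hv]
        rw [e1]
        have h5 : 0 < v ^ (s - 1) := Real.rpow_pos_of_pos hv _
        rcases le_total v w with h6 | h6
        · nlinarith [mul_pos hv h5, mul_le_mul_of_nonneg_right h6 h4.le]
        · have h7 : w ^ (s - 1) ≤ v ^ (s - 1) := Real.rpow_le_rpow hw0.le h6 (by linarith)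
          nlinarith [mul_le_mul_of_nonneg_left h7 hv.le, mul_pos hw0 h4]
  have h1 := key u v huv
  have h2 := key (-v) (-u) (by linarith)
  rw [abs_neg, oddPow_neg, oddPow_neg] at h2
  constructor
  · nlinarith
  · nlinarith

theorem CrossBound.comp {g h : ℝ → ℝ} {θ₁ θ₂ a b c d : ℝ} (hg : CrossBound g θ₁ a b c d)
    (hh : CrossBound h θ₂ (g a) (g b) (g c) (g d)) (hθ : 0 ≤ θ₂) (h1 : a < b) (h3 : c < d)
    (g1 : g a < g b) (g3 : g c < g d) (k1 : h (g a) < h (g b)) (k3 : h (g c) < h (g d)) :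
    CrossBound (fun x => h (g x)) (θ₂ * θ₁) a b c d := by
  have y0 : 0 < (b - a) * (d - c) := mul_pos (by linarith) (by linarith)
  have y1 : 0 < (g b - g a) * (g d - g c) := mul_pos (by linarith) (by linarith)
  have y2 : 0 < (h (g b) - h (g a)) * (h (g d) - h (g c)) := mul_pos (by linarith) (by linarith)
  have key : ∀ X0 X1 X2 Y0 Y1 Y2 : ℝ, 0 < Y0 → 0 < Y1 → 0 < Y2 → θ₁ * (Y1 * X0) ≤ X1 * Y0 →
      θ₂ * (Y2 * X1) ≤ X2 * Y1 → θ₂ * θ₁ * (Y2 * X0) ≤ X2 * Y0 := by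
    intro X0 X1 X2 Y0 Y1 Y2 y0 y1 y2 hg hh
    have e1 := mul_le_mul_of_nonneg_left hg (mul_nonneg hθ y2.le)
    have e2 := mul_le_mul_of_nonneg_right hh y0.le
    refine le_of_mul_le_mul_right ?_ y1
    linarith
  exact key _ _ _ _ _ _ y0 y1 y2 hg hh

theorem CrossBound.mono {g : ℝ → ℝ} {θ θ' a b c d : ℝ} (hg : CrossBound g θ a b c d)
    (h : θ' ≤ θ) (h1 : a < b) (h2 : b < c) (h3 : c < d)
    (g1 : g a < g b) (g3 : g c < g d) : CrossBound g θ' a b c d := by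
  refine le_trans ?_ hg
  have : 0 ≤ (g b - g a) * (g d - g c) * ((c - b) * (d - a)) := by
    have := sub_pos.2 g1; have := sub_pos.2 g3
    have := sub_pos.2 h2; have := sub_pos.2 (h1.trans (h2.trans h3))
    positivity
  exact mul_le_mul_of_nonneg_right h this

theorem slope_eq {g : ℝ → ℝ} {a b : ℝ} (hab : a < b)
    (hg : ∀ x ∈ Icc a b, DifferentiableAt ℝ g x) :
    ∃ ξ ∈ Ioo a b, g b - g a = deriv g ξ * (b - a) := by
  obtain ⟨ξ, hξ, h⟩ := exists_deriv_eq_slope g hab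
    (fun x hx => (hg x hx).continuousAt.continuousWithinAt)
    (fun x hx => (hg x (Ioo_subset_Icc_self hx)).differentiableWithinAt)
  refine ⟨ξ, hξ, ?_⟩
  rw [h, div_mul_cancel₀]
  linarith

/-- On the interval of radius `r` around `p`, `g` is an increasing diffeomorphism with
bounded derivative and nonlinearity. -/
structure TameOn (g : ℝ → ℝ) (p r η F L : ℝ) : Prop where
  r_pos : 0 < r
  η_pos : 0 < η
  L_nonneg : 0 ≤ L
  diff : ∀ x ∈ Ioo (p - r) (p + r), DifferentiableAt ℝ g x
  lower : ∀ x ∈ Ioo (p - r) (p + r), η ≤ deriv g x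
  upper : ∀ x ∈ Ioo (p - r) (p + r), deriv g x ≤ F
  nonlin : ∀ x ∈ Ioo (p - r) (p + r), ∀ y ∈ Ioo (p - r) (p + r),
    deriv g x ≤ deriv g y * Real.exp (L * |x - y|)

theorem exists_tameOn {g : ℝ → ℝ} {p : ℝ} (hg : ContDiffAt ℝ 2 g p) (hp : 0 < deriv g p) :
    ∃ r η F L, TameOn g p r η F L := by
  have h1 : ContDiffAt ℝ 1 (deriv g) p := by
    exact (hg.fderiv_right (m := 1) (by norm_num)).clm_apply contDiffAt_const
  obtain ⟨K, t, ht, hK⟩ := h1.exists_lipschitzOnWith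
  have e1 : ∀ᶠ x in 𝓝 p, DifferentiableAt ℝ g x := by
    have := hg.eventually (by simp)
    filter_upwards [this] with x hx using hx.differentiableAt (by norm_num)
  have e2 : ∀ᶠ x in 𝓝 p, deriv g p / 2 < deriv g x :=
    h1.continuousAt.eventually (lt_mem_nhds (by linarith))
  have e3 : ∀ᶠ x in 𝓝 p, deriv g x < 2 * deriv g p :=
    h1.continuousAt.eventually (gt_mem_nhds (by linarith))
  obtain ⟨r, hr, hball⟩ := Metric.eventually_nhds_iff_ball.1 (e1.and (e2.and (e3.and ht)))
  have hb : ∀ x ∈ Ioo (p - r) (p + r), x ∈ Metric.ball p r := by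
    intro x hx; rwa [Real.ball_eq_Ioo]
  refine ⟨r, deriv g p / 2, 2 * deriv g p, K / (deriv g p / 2), hr, by positivity, by positivity,
    fun x hx => (hball x (hb x hx)).1, fun x hx => (hball x (hb x hx)).2.1.le,
    fun x hx => (hball x (hb x hx)).2.2.1.le, ?_⟩
  intro x hx y hy
  have hl := hK.dist_le_mul x (hball x (hb x hx)).2.2.2 y (hball y (hb y hy)).2.2.2
  rw [Real.dist_eq, Real.dist_eq] at hl
  have hy' := (hball y (hb y hy)).2.1
  have h3 := le_abs_self (deriv g x - deriv g y)
  have h4 := Real.add_one_le_exp (K / (deriv g p / 2) * |x - y|)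
  have h5 : (K : ℝ) * |x - y| ≤ deriv g y * (K / (deriv g p / 2) * |x - y|) := by
    have : (K : ℝ) * |x - y| = (deriv g p / 2) * (K / (deriv g p / 2) * |x - y|) := by
      field_simp
    rw [this]
    gcongr
  nlinarith

namespace TameOn

variable {g : ℝ → ℝ} {p r η F L : ℝ}

theorem lin_lower (h : TameOn g p r η F L) {x y : ℝ} (hx : x ∈ Ioo (p - r) (p + r))
    (hy : y ∈ Ioo (p - r) (p + r)) (hxy : x < y) : η * (y - x) ≤ g y - g x := by
  obtain ⟨ξ, hξ, e⟩ := slope_eq hxy fun z hz => h.diff z ⟨hx.1.trans_le hz.1, hz.2.trans_lt hy.2⟩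
  rw [e]
  exact mul_le_mul_of_nonneg_right (h.lower ξ ⟨hx.1.trans hξ.1, hξ.2.trans hy.2⟩) (by linarith)

theorem lin_upper (h : TameOn g p r η F L) {x y : ℝ} (hx : x ∈ Ioo (p - r) (p + r))
    (hy : y ∈ Ioo (p - r) (p + r)) (hxy : x < y) : g y - g x ≤ F * (y - x) := by
  obtain ⟨ξ, hξ, e⟩ := slope_eq hxy fun z hz => h.diff z ⟨hx.1.trans_le hz.1, hz.2.trans_lt hy.2⟩
  rw [e]
  exact mul_le_mul_of_nonneg_right (h.upper ξ ⟨hx.1.trans hξ.1, hξ.2.trans hy.2⟩) (by linarith)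

theorem lt (h : TameOn g p r η F L) {x y : ℝ} (hx : x ∈ Ioo (p - r) (p + r))
    (hy : y ∈ Ioo (p - r) (p + r)) (hxy : x < y) : g x < g y := by
  have := h.lin_lower hx hy hxy
  have := mul_pos h.η_pos (sub_pos.2 hxy)
  linarith

theorem mem_p (h : TameOn g p r η F L) : p ∈ Ioo (p - r) (p + r) :=
  ⟨by linarith [h.r_pos], by linarith [h.r_pos]⟩

theorem η_le_F (h : TameOn g p r η F L) : η ≤ F := (h.lower p h.mem_p).trans (h.upper p h.mem_p)

theorem F_pos (h : TameOn g p r η F L) : 0 < F := h.η_pos.trans_le h.η_le_F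

theorem crossBound (h : TameOn g p r η F L) {a b c d : ℝ} (ha : p - r < a) (hd : d < p + r)
    (h1 : a < b) (h2 : b < c) (h3 : c < d) :
    CrossBound g (Real.exp (-(2 * L * (d - a)))) a b c d := by
  have mem : ∀ x, a ≤ x → x ≤ d → x ∈ Ioo (p - r) (p + r) := fun x hx hx' =>
    ⟨by linarith, by linarith⟩
  obtain ⟨l, hl, el⟩ := slope_eq h1 fun z hz =>
    h.diff z (mem z (by linarith [hz.1]) (by linarith [hz.2]))
  obtain ⟨m, hm, em⟩ := slope_eq h2 fun z hz =>
    h.diff z (mem z (by linarith [hz.1]) (by linarith [hz.2]))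
  obtain ⟨k, hk, ek⟩ := slope_eq h3 fun z hz =>
    h.diff z (mem z (by linarith [hz.1]) (by linarith [hz.2]))
  obtain ⟨t, ht, et⟩ := slope_eq (h1.trans (h2.trans h3)) fun z hz =>
    h.diff z (mem z hz.1 hz.2)
  have ml := mem l (by linarith [hl.1]) (by linarith [hl.2])
  have mm := mem m (by linarith [hm.1]) (by linarith [hm.2])
  have mk := mem k (by linarith [hk.1]) (by linarith [hk.2])
  have mt := mem t ht.1.le ht.2.le
  have pos : ∀ x ∈ Ioo (p - r) (p + r), 0 < deriv g x := fun x hx => h.η_pos.trans_le (h.lower x hx)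
  have n1 : deriv g l ≤ deriv g m * Real.exp (L * (d - a)) := by
    refine (h.nonlin l ml m mm).trans ?_
    have := pos m mm
    have := h.L_nonneg
    have : |l - m| ≤ d - a := abs_le.2 ⟨by linarith [hl.1, hm.2], by linarith [hl.2, hm.1]⟩
    gcongr
  have n2 : deriv g k ≤ deriv g t * Real.exp (L * (d - a)) := by
    refine (h.nonlin k mk t mt).trans ?_
    have := pos t mt
    have := h.L_nonneg
    have : |k - t| ≤ d - a := abs_le.2 ⟨by linarith [hk.1, ht.2], by linarith [hk.2, ht.1]⟩
    gcongr
  have n3 : deriv g l * deriv g k * Real.exp (-(2 * L * (d - a))) ≤ deriv g m * deriv g t := by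
    have := mul_le_mul n1 n2 (pos k mk).le (mul_pos (pos m mm) (Real.exp_pos _)).le
    have e : Real.exp (L * (d - a)) * Real.exp (L * (d - a)) * Real.exp (-(2 * L * (d - a))) =
        1 := by
      rw [← Real.exp_add, ← Real.exp_add, ← Real.exp_zero]; congr 1; ring
    calc _ ≤ (deriv g m * Real.exp (L * (d - a)) * (deriv g t * Real.exp (L * (d - a)))) *
          Real.exp (-(2 * L * (d - a))) := by gcongr
      _ = deriv g m * deriv g t * (Real.exp (L * (d - a)) * Real.exp (L * (d - a)) *
          Real.exp (-(2 * L * (d - a)))) := by ring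
      _ = _ := by rw [e, mul_one]
  unfold CrossBound
  rw [el, em, ek, et]
  have : 0 ≤ (b - a) * (d - c) * ((c - b) * (d - a)) := by
    have := sub_pos.2 h1; have := sub_pos.2 h2; have := sub_pos.2 h3
    have : 0 < d - a := by linarith
    positivity
  have := mul_le_mul_of_nonneg_right n3 this
  linarith

end TameOn

/-- Local normal form at a non-flat critical point. -/
theorem IsNonFlatCritPt.exists_tameOn {f : ℝ → ℝ} {c s : ℝ} (h : IsNonFlatCritPt f c s)
    (hf : StrictMono f) : 1 < s ∧ ∃ φ r η F L, TameOn φ c r η F L ∧ φ c = 0 ∧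
      ∀ x ∈ Ioo (c - r) (c + r), f x = f c + oddPow s (φ x) := by
  obtain ⟨hs, W, φ, hW, hcW, hφ, hφc, hφ', -, hfW⟩ := h
  refine ⟨hs, φ, ?_⟩
  have hc : ContDiffAt ℝ 3 φ c := hφ.contDiffAt (hW.mem_nhds hcW)
  have hpos : 0 < deriv φ c := by
    rcases lt_or_gt_of_ne (hφ' c hcW) with hneg | hpos
    · exfalso
      have hd : HasDerivAt φ (deriv φ c) c := (hc.differentiableAt (by norm_num)).hasDerivAt
      have h1 : ∀ᶠ x in 𝓝[>] c, φ x < φ c := by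
        have := hasDerivAt_iff_tendsto_slope.1 hd
        have h2 := this.eventually (gt_mem_nhds hneg)
        have h3 : ∀ᶠ x in 𝓝[>] c, slope φ c x < 0 :=
          h2.filter_mono (nhdsWithin_mono _ fun x hx => ne_of_gt hx)
        filter_upwards [h3, self_mem_nhdsWithin] with x hx hx'
        rw [slope_def_field, div_neg_iff] at hx
        have : 0 < x - c := sub_pos.2 hx'
        rcases hx with hx | hx <;> linarith [hx.1, hx.2]
      have h4 : ∀ᶠ x in 𝓝[>] c, x ∈ W := (hW.mem_nhds hcW : W ∈ 𝓝 c) |> mem_nhdsWithin_of_mem_nhds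
      obtain ⟨x, ⟨hx1, hx2⟩, hx3⟩ := ((h1.and h4).and self_mem_nhdsWithin).exists
      have h5 : f c < f x := hf hx3
      have h6 := oddPow_strictMono hs hx1
      rw [hφc, oddPow_zero] at h6
      have h7 := hfW x hx2
      change f x = f c + oddPow s (φ x) at h7
      linarith
    · exact hpos
  obtain ⟨r, η, F, L, hT⟩ := MCircle.exists_tameOn (hc.of_le (by norm_num)) hpos
  obtain ⟨r', hr', hb⟩ := Metric.mem_nhds_iff.1 (hW.mem_nhds hcW)
  have sub : ∀ x ∈ Ioo (c - min r r') (c + min r r'), x ∈ Ioo (c - r) (c + r) := fun x hx =>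
    ⟨by linarith [hx.1, min_le_left r r'], by linarith [hx.2, min_le_left r r']⟩
  refine ⟨min r r', η, F, L, ⟨lt_min hT.r_pos hr', hT.η_pos, hT.L_nonneg,
    fun x hx => hT.diff x (sub x hx), fun x hx => hT.lower x (sub x hx),
    fun x hx => hT.upper x (sub x hx),
    fun x hx y hy => hT.nonlin x (sub x hx) y (sub y hy)⟩, hφc, ?_⟩
  intro x hx
  refine hfW x (hb ?_)
  rw [Real.ball_eq_Ioo]
  exact ⟨by linarith [hx.1, min_le_right r r'], by linarith [hx.2, min_le_right r r']⟩

/-- The full set of critical points of the lift. -/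
def critSet (C : Finset ℝ) : Set ℝ := {x | ∃ c ∈ C, ∃ k : ℤ, x = c + k}

theorem exists_uniform (R : ℝ → ℕ → Prop) (mono : ∀ x N M, N ≤ M → R x N → R x M)
    (per : ∀ x N, ∀ m : ℤ, R x N → R (x + m) N)
    (loc : ∀ p ∈ Ico (0 : ℝ) 1, ∃ N, ∀ᶠ x in 𝓝 p, R x N) : ∃ N, ∀ x, R x N := by
  have loc' : ∀ p : ℝ, ∃ N, ∀ᶠ x in 𝓝 p, R x N := by
    intro p
    obtain ⟨N, hN⟩ := loc (Int.fract p) ⟨Int.fract_nonneg p, Int.fract_lt_one p⟩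
    refine ⟨N, ?_⟩
    have ht : Tendsto (fun x : ℝ => x - ⌊p⌋) (𝓝 p) (𝓝 (Int.fract p)) := by
      have : Continuous fun x : ℝ => x - ⌊p⌋ := by fun_prop
      exact this.tendsto p
    filter_upwards [ht.eventually hN] with x hx
    simpa using per _ N ⌊p⌋ hx
  have : ∃ N, ∀ x ∈ Icc (0 : ℝ) 1, R x N := by
    refine isCompact_Icc.induction_on (p := fun s => ∃ N, ∀ x ∈ s, R x N) ?_ ?_ ?_ ?_
    · exact ⟨0, by simp⟩
    · rintro s t hst ⟨N, hN⟩
      exact ⟨N, fun x hx => hN x (hst hx)⟩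
    · rintro s t ⟨N, hN⟩ ⟨M, hM⟩
      refine ⟨max N M, fun x hx => ?_⟩
      rcases hx with hx | hx
      · exact mono _ _ _ (le_max_left _ _) (hN x hx)
      · exact mono _ _ _ (le_max_right _ _) (hM x hx)
    · intro p _
      obtain ⟨N, hN⟩ := loc' p
      exact ⟨_, mem_nhdsWithin_of_mem_nhds hN, N, fun x hx => hx⟩
  obtain ⟨N, hN⟩ := this
  refine ⟨N, fun x => ?_⟩
  have := per _ N ⌊x⌋ (hN (Int.fract x) ⟨Int.fract_nonneg x, (Int.fract_lt_one x).le⟩)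
  simpa using this

theorem critSet_add_int {C : Finset ℝ} {x : ℝ} (m : ℤ) : x + m ∈ critSet C ↔ x ∈ critSet C := by
  constructor
  · rintro ⟨c, hc, k, h⟩
    exact ⟨c, hc, k - m, by push_cast; linarith⟩
  · rintro ⟨c, hc, k, h⟩
    exact ⟨c, hc, k + m, by push_cast; linarith⟩

namespace IsCircleMapLift

variable {f : ℝ → ℝ}

theorem map_add_nat (h : IsCircleMapLift f) (x : ℝ) (m : ℕ) : f (x + m) = f x + m := by
  induction m with
  | zero => simp
  | succ m ih => push_cast; rw [← add_assoc, h.periodic, ih]; ring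

theorem map_add_int (h : IsCircleMapLift f) (x : ℝ) (m : ℤ) : f (x + m) = f x + m := by
  rcases Int.eq_nat_or_neg m with ⟨k, rfl | rfl⟩
  · exact_mod_cast h.map_add_nat x k
  · have := h.map_add_nat (x + ((-(k : ℤ) : ℤ) : ℝ)) k
    push_cast at this ⊢
    rw [show x + -(k : ℝ) + k = x by ring] at this
    linarith

theorem deriv_add_int (h : IsCircleMapLift f) (x : ℝ) (m : ℤ) :
    deriv f (x + m) = deriv f x := by
  have : (fun y => f (y + m)) = fun y => f y + m := funext fun y => h.map_add_int y m
  rw [← deriv_comp_add_const, this, deriv_add_const]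

theorem differentiableAt (h : IsCircleMapLift f) (x : ℝ) : DifferentiableAt ℝ f x :=
  h.smooth.differentiable (by norm_num) x

theorem deriv_nonneg (h : IsCircleMapLift f) (x : ℝ) : 0 ≤ deriv f x :=
  h.mono.monotone.deriv_nonneg

theorem continuous_deriv (h : IsCircleMapLift f) : Continuous (deriv f) :=
  h.smooth.continuous_deriv (by norm_num)

end IsCircleMapLift

/-- Normal form of `f` around a critical point `p`. -/
structure NormalForm (f : ℝ → ℝ) (p s : ℝ) (φ : ℝ → ℝ) (r η F L : ℝ) : Prop where
  tame : TameOn φ p r η F L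
  one_lt : 1 < s
  zero : φ p = 0
  eq : ∀ x ∈ Ioo (p - r) (p + r), f x = f p + oddPow s (φ x)
  crit : deriv f p = 0

namespace NormalForm

variable {f φ : ℝ → ℝ} {p s r η F L : ℝ}

theorem deriv_eq (h : NormalForm f p s φ r η F L) {x : ℝ} (hx : x ∈ Ioo (p - r) (p + r)) :
    deriv f x = s * |φ x| ^ (s - 1) * deriv φ x := by
  by_cases hxp : x = p
  · subst hxp
    rw [h.crit, h.zero, abs_zero, Real.zero_rpow (by linarith [h.one_lt])]; ring
  · have h0 : φ x ≠ 0 := by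
      rw [← h.zero]
      rcases lt_or_gt_of_ne hxp with h1 | h1
      · exact (h.tame.lt hx h.tame.mem_p h1).ne
      · exact (h.tame.lt h.tame.mem_p hx h1).ne'
    have h1 : HasDerivAt (fun y => f p + oddPow s (φ y)) (s * |φ x| ^ (s - 1) * deriv φ x) x :=
      ((hasDerivAt_oddPow h0).comp x (h.tame.diff x hx).hasDerivAt).const_add _
    have h2 : f =ᶠ[𝓝 x] fun y => f p + oddPow s (φ y) := by
      filter_upwards [Ioo_mem_nhds hx.1 hx.2] with y hy using h.eq y hy
    exact (h1.congr_of_eventuallyEq h2).deriv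

theorem deriv_mul_le (h : NormalForm f p s φ r η F L) {x y : ℝ} (hx : x ∈ Ioo (p - r) (p + r))
    (hy : y ∈ Ioo (p - r) (p + r)) (hxy : x < y) :
    deriv f x * (y - x) ≤ 2 * s * (F / η) * (f y - f x) ∧
    deriv f y * (y - x) ≤ 2 * s * (F / η) * (f y - f x) := by
  have hη := h.tame.η_pos
  have hF := h.tame.F_pos
  obtain ⟨k1, k2⟩ := oddPow_deriv_le h.one_lt (h.tame.lt hx hy hxy)
  have l1 := h.tame.lin_lower hx hy hxy
  have e : f y - f x = oddPow s (φ y) - oddPow s (φ x) := by rw [h.eq x hx, h.eq y hy]; ring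
  have hl : 0 ≤ (φ y - φ x) / η := by
    have := h.tame.lt hx hy hxy
    exact div_nonneg (by linarith) hη.le
  have key : ∀ z ∈ Ioo (p - r) (p + r),
      s * |φ z| ^ (s - 1) * (φ y - φ x) ≤ 2 * s * (oddPow s (φ y) - oddPow s (φ x)) →
      deriv f z * (y - x) ≤ 2 * s * (F / η) * (f y - f x) := by
    intro z hz hk
    rw [h.deriv_eq hz, e]
    have hs : 0 ≤ s * |φ z| ^ (s - 1) :=
      mul_nonneg (by linarith [h.one_lt]) (Real.rpow_nonneg (abs_nonneg _) _)
    have h3 : y - x ≤ (φ y - φ x) / η := by rw [le_div_iff₀ hη]; linarith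
    calc s * |φ z| ^ (s - 1) * deriv φ z * (y - x)
        ≤ s * |φ z| ^ (s - 1) * F * ((φ y - φ x) / η) := by
          have := h.tame.upper z hz
          have := sub_pos.2 hxy
          gcongr
      _ = (F / η) * (s * |φ z| ^ (s - 1) * (φ y - φ x)) := by ring
      _ ≤ (F / η) * (2 * s * (oddPow s (φ y) - oddPow s (φ x))) := by gcongr
      _ = _ := by ring
  exact ⟨key x hx k1, key y hy k2⟩

theorem deriv_le_of_between (h : NormalForm f p s φ r η F L) {x y : ℝ}
    (hx : x ∈ Ioo (p - r) (p + r)) (hy : y ∈ Ioo (p - r) (p + r))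
    (hxy : p ≤ y ∧ y ≤ x ∨ x ≤ y ∧ y ≤ p) : deriv f y ≤ F / η * deriv f x := by
  have hη := h.tame.η_pos
  have hF := h.tame.F_pos
  have hm : ∀ u ∈ Ioo (p - r) (p + r), ∀ v ∈ Ioo (p - r) (p + r), u ≤ v → φ u ≤ φ v := by
    intro u hu v hv huv
    rcases huv.eq_or_lt with rfl | huv
    · exact le_rfl
    · exact (h.tame.lt hu hv huv).le
  have habs : |φ y| ≤ |φ x| := by
    have hp := h.tame.mem_p
    rcases hxy with ⟨h1, h2⟩ | ⟨h1, h2⟩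
    · have a1 := hm p hp y hy h1
      have a2 := hm y hy x hx h2
      rw [h.zero] at a1
      rw [abs_of_nonneg a1, abs_of_nonneg (a1.trans a2)]; exact a2
    · have a1 := hm y hy p hp h2
      have a2 := hm x hx y hy h1
      rw [h.zero] at a1
      rw [abs_of_nonpos a1, abs_of_nonpos (a2.trans a1)]; linarith
  rw [h.deriv_eq hx, h.deriv_eq hy]
  have h1 : |φ y| ^ (s - 1) ≤ |φ x| ^ (s - 1) :=
    Real.rpow_le_rpow (abs_nonneg _) habs (by linarith [h.one_lt])
  have h2 : deriv φ y ≤ F / η * deriv φ x := by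
    have := h.tame.lower x hx
    calc deriv φ y ≤ F := h.tame.upper y hy
      _ = F / η * η := by field_simp
      _ ≤ _ := by gcongr
  have h3 : 0 ≤ |φ x| ^ (s - 1) := Real.rpow_nonneg (abs_nonneg _) _
  have hs : 0 < s := by linarith [h.one_lt]
  have h4 : 0 < deriv φ y := hη.trans_le (h.tame.lower y hy)
  calc s * |φ y| ^ (s - 1) * deriv φ y ≤ s * |φ x| ^ (s - 1) * (F / η * deriv φ x) := by gcongr
    _ = _ := by ring

theorem crossBound (h : NormalForm f p s φ r η F L) {a b c d : ℝ} (ha : p - r < a)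
    (hd : d < p + r) (h1 : a < b) (h2 : b < c) (h3 : c < d) (hp : p < a ∨ d < p) :
    CrossBound f (Real.exp (-(2 * L * (d - a)))) a b c d := by
  have mem : ∀ x, a ≤ x → x ≤ d → x ∈ Ioo (p - r) (p + r) := fun x hx hx' =>
    ⟨by linarith, by linarith⟩
  have ma := mem a le_rfl (by linarith)
  have mb := mem b (by linarith) (by linarith)
  have mc := mem c (by linarith) (by linarith)
  have md := mem d (by linarith) (by linarith)
  have l1 := h.tame.lt ma mb h1
  have l2 := h.tame.lt mb mc h2
  have l3 := h.tame.lt mc md h3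
  have hm := oddPow_strictMono h.one_lt
  have hz : 0 < φ a ∨ φ d < 0 := by
    rw [← h.zero]
    exact hp.imp (h.tame.lt h.tame.mem_p ma) (h.tame.lt md h.tame.mem_p)
  have key := (h.tame.crossBound ha hd h1 h2 h3).comp
    (oddPow_crossBound h.one_lt.le l1 l2 l3 hz) zero_le_one h1 h3 l1 l3 (hm l1) (hm l3)
  simp only [CrossBound] at key ⊢
  rw [h.eq a ma, h.eq b mb, h.eq c mc, h.eq d md]
  linarith

end NormalForm

namespace IsMulticriticalLift

variable {f : ℝ → ℝ} {C : Finset ℝ} {dc : ℝ → ℝ}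

theorem deriv_eq_zero_iff (h : IsMulticriticalLift f C dc) (x : ℝ) :
    deriv f x = 0 ↔ x ∈ critSet C := h.2.2.2.1 x

theorem deriv_pos (h : IsMulticriticalLift f C dc) {x : ℝ} (hx : x ∉ critSet C) :
    0 < deriv f x :=
  (h.1.deriv_nonneg x).lt_of_ne fun e => hx ((h.deriv_eq_zero_iff x).1 e.symm)

theorem exists_normalForm (h : IsMulticriticalLift f C dc) {c : ℝ} (hc : c ∈ C) :
    ∃ s φ r η F L, NormalForm f c s φ r η F L := by
  obtain ⟨hs, φ, r, η, F, L, hT, h0, he⟩ := (h.2.2.2.2 c hc).exists_tameOn h.1.mono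
  exact ⟨dc c, φ, r, η, F, L, hT, hs, h0, he, (h.deriv_eq_zero_iff c).2 ⟨c, hc, 0, by simp⟩⟩

theorem local_form (h : IsMulticriticalLift f C dc) {p : ℝ} (hp : p ∈ Ico (0 : ℝ) 1) :
    (∃ s φ r η F L, NormalForm f p s φ r η F L) ∨ ∃ r η F L, TameOn f p r η F L := by
  by_cases hx : p ∈ critSet C
  · left
    obtain ⟨c, hc, k, e⟩ := hx
    have hc1 := h.2.2.1 hc
    have : k = 0 := by
      have h1 : (-1 : ℝ) < k := by linarith [hp.1, hc1.2]
      have h2 : (k : ℝ) < 1 := by linarith [hp.2, hc1.1]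
      have h3 : -1 < k := by exact_mod_cast h1
      have h4 : k < 1 := by exact_mod_cast h2
      omega
    subst this
    simp only [Int.cast_zero, add_zero] at e
    exact e ▸ h.exists_normalForm hc
  · right
    exact exists_tameOn (h.1.smooth.contDiffAt.of_le (by norm_num)) (h.deriv_pos hx)

theorem exists_deriv_le (h : IsMulticriticalLift f C dc) :
    ∃ F : ℝ, 0 < F ∧ ∀ x, deriv f x ≤ F := by
  obtain ⟨N, hN⟩ := exists_uniform (fun x N => deriv f x ≤ N)
    (fun x N M hNM hx => hx.trans (by exact_mod_cast hNM))
    (fun x N m hx => by rwa [h.1.deriv_add_int])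
    (fun p _ => by
      obtain ⟨N, hN⟩ := exists_nat_gt (deriv f p)
      refine ⟨N, ?_⟩
      filter_upwards [h.1.continuous_deriv.continuousAt.eventually (gt_mem_nhds hN)] with x hx
        using hx.le)
  exact ⟨N + 1, by positivity, fun x => (hN x).trans (by linarith)⟩

theorem exists_deriv_mul_le (h : IsMulticriticalLift f C dc) :
    ∃ A : ℝ, 0 < A ∧ ∀ x y, |y - x| ≤ 4 → deriv f x * |y - x| ≤ A * |f y - f x| := by
  obtain ⟨N, hN⟩ := exists_uniform
    (fun x N => ∀ y, |y - x| < 1 / (N + 1 : ℝ) → deriv f x * |y - x| ≤ N * |f y - f x|)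
    (fun x N M hNM hx y hy => by
      have hNM' : (N : ℝ) ≤ M := by exact_mod_cast hNM
      refine (hx y (hy.trans_le ?_)).trans ?_ <;> gcongr)
    (fun x N m hx y hy => by
      have := hx (y - m) (by rwa [show y - m - x = y - (x + m) by ring])
      have e : f (y - m) = f y - m := by
        have := h.1.map_add_int (y - m) m
        rw [sub_add_cancel] at this; linarith
      rw [h.1.deriv_add_int, h.1.map_add_int]
      rw [e] at this
      convert this using 3 <;> ring)
    (fun p hp => by
      have key : ∃ r > 0, ∃ B : ℝ, ∀ x ∈ Ioo (p - r) (p + r), ∀ y ∈ Ioo (p - r) (p + r),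
          x < y → deriv f x * (y - x) ≤ B * (f y - f x) ∧
            deriv f y * (y - x) ≤ B * (f y - f x) := by
        rcases h.local_form hp with ⟨s, φ, r, η, F, L, hn⟩ | ⟨r, η, F, L, ht⟩
        · exact ⟨r, hn.tame.r_pos, 2 * s * (F / η), fun x hx y hy hxy => hn.deriv_mul_le hx hy hxy⟩
        · refine ⟨r, ht.r_pos, F / η, fun x hx y hy hxy => ?_⟩
          have hη := ht.η_pos
          have hF := ht.F_pos
          have : ∀ z ∈ Ioo (p - r) (p + r), deriv f z * (y - x) ≤ F / η * (f y - f x) := by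
            intro z hz
            calc deriv f z * (y - x) ≤ F * (y - x) :=
                  mul_le_mul_of_nonneg_right (ht.upper z hz) (by linarith)
              _ = F / η * (η * (y - x)) := by field_simp
              _ ≤ _ := by
                have := ht.lin_lower hx hy hxy
                gcongr
          exact ⟨this x hx, this y hy⟩
      obtain ⟨r, hr, B, hB⟩ := key
      obtain ⟨N₁, hN₁⟩ := exists_nat_gt B
      obtain ⟨N₂, hN₂⟩ := exists_nat_gt (2 / r)
      refine ⟨max N₁ N₂, ?_⟩
      have hr2 : 0 < r / 2 := by linarith
      filter_upwards [Ioo_mem_nhds (show p - r / 2 < p by linarith)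
        (show p < p + r / 2 by linarith)] with x hx y hy
      have hb : B ≤ ((max N₁ N₂ : ℕ) : ℝ) := by push_cast; exact hN₁.le.trans (le_max_left _ _)
      have hy' : |y - x| < r / 2 := by
        refine hy.trans_le ?_
        rw [div_le_iff₀ (by positivity)]
        have : (2 / r) ≤ ((max N₁ N₂ : ℕ) : ℝ) := by
          push_cast; exact hN₂.le.trans (le_max_right _ _)
        have h2 : r / 2 * (2 / r) = 1 := by field_simp
        nlinarith
      rw [abs_lt] at hy'
      have hx' : x ∈ Ioo (p - r) (p + r) := ⟨by linarith [hx.1], by linarith [hx.2]⟩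
      have hy'' : y ∈ Ioo (p - r) (p + r) := ⟨by linarith [hx.1], by linarith [hx.2]⟩
      rcases lt_trichotomy x y with hxy | rfl | hxy
      · have hf := h.1.mono hxy
        rw [abs_of_pos (sub_pos.2 hxy), abs_of_pos (sub_pos.2 hf)]
        exact (hB x hx' y hy'' hxy).1.trans (mul_le_mul_of_nonneg_right hb (by linarith))
      · simp
      · have hf := h.1.mono hxy
        rw [abs_sub_comm, abs_sub_comm (f y), abs_of_pos (sub_pos.2 hxy),
          abs_of_pos (sub_pos.2 hf)]
        exact (hB y hy'' x hx' hxy).2.trans (mul_le_mul_of_nonneg_right hb (by linarith)))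
  -- from short to long distances
  set ε : ℝ := 1 / (N + 2 : ℝ) with hε
  have hε0 : 0 < ε := by positivity
  have hε1 : ε < 1 / (N + 1 : ℝ) := by
    rw [hε]; apply one_div_lt_one_div_of_lt <;> linarith [(Nat.cast_nonneg N : (0 : ℝ) ≤ N)]
  refine ⟨(N + 1) * (1 + 4 / ε), by positivity, fun x y hxy => ?_⟩
  have hn : (0 : ℝ) ≤ N := Nat.cast_nonneg N
  rcases le_or_gt |y - x| ε with hs | hs
  · refine (hN x y (hs.trans_lt hε1)).trans (mul_le_mul_of_nonneg_right ?_ (abs_nonneg _))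
    have : 0 ≤ 4 / ε := by positivity
    nlinarith
  · have hd := h.1.deriv_nonneg x
    have key : deriv f x * ε ≤ N * |f y - f x| := by
      rcases le_total x y with hxy' | hxy'
      · have h1 := hN x (x + ε) (by rw [add_sub_cancel_left, abs_of_pos hε0]; exact hε1)
        rw [add_sub_cancel_left, abs_of_pos hε0] at h1
        rw [abs_of_nonneg (by linarith)] at hs
        have h2 : f (x + ε) ≤ f y := h.1.mono.monotone (by linarith)
        have h3 : f x ≤ f (x + ε) := h.1.mono.monotone (by linarith)
        refine h1.trans (mul_le_mul_of_nonneg_left ?_ hn)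
        rw [abs_of_nonneg (by linarith), abs_of_nonneg (by linarith)]; linarith
      · have h1 := hN x (x - ε) (by
          rw [show x - ε - x = -ε by ring, abs_neg, abs_of_pos hε0]; exact hε1)
        rw [show x - ε - x = -ε by ring, abs_neg, abs_of_pos hε0] at h1
        rw [abs_of_nonpos (by linarith)] at hs
        have h2 : f y ≤ f (x - ε) := h.1.mono.monotone (by linarith)
        have h3 : f (x - ε) ≤ f x := h.1.mono.monotone (by linarith)
        refine h1.trans (mul_le_mul_of_nonneg_left ?_ hn)
        rw [abs_of_nonpos (by linarith), abs_of_nonpos (by linarith)]; linarith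
    calc deriv f x * |y - x| ≤ deriv f x * 4 := by gcongr
      _ = 4 / ε * (deriv f x * ε) := by field_simp
      _ ≤ 4 / ε * (N * |f y - f x|) := by gcongr
      _ ≤ (N + 1) * (1 + 4 / ε) * |f y - f x| := by
        have h1 : 0 ≤ 4 / ε := by positivity
        have h2 := abs_nonneg (f y - f x)
        rw [← mul_assoc]
        refine mul_le_mul_of_nonneg_right ?_ h2
        nlinarith

theorem exists_min_deriv_le (h : IsMulticriticalLift f C dc) :
    ∃ A : ℝ, 0 < A ∧ ∀ l x m, l ≤ x → x ≤ m → (∀ t ∈ Icc l m, t ∉ critSet C) →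
      min (deriv f l) (deriv f m) ≤ A * deriv f x := by
  obtain ⟨F, hF0, hF⟩ := h.exists_deriv_le
  obtain ⟨N, hN⟩ := exists_uniform
    (fun x N => ∀ l m, l ≤ x → x ≤ m → (∀ t ∈ Icc l m, t ∉ critSet C) →
      min (deriv f l) (deriv f m) ≤ N * deriv f x)
    (fun x N M hNM hx l m h1 h2 h3 => (hx l m h1 h2 h3).trans
      (mul_le_mul_of_nonneg_right (by exact_mod_cast hNM) (h.1.deriv_nonneg x)))
    (fun x N k hx l m h1 h2 h3 => by
      have e : ∀ z, deriv f (z - k) = deriv f z := fun z => by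
        rw [← h.1.deriv_add_int (z - k) k, sub_add_cancel]
      have := hx (l - k) (m - k) (by linarith) (by linarith) (fun t ht hc => by
        refine h3 (t + k) ⟨by linarith [ht.1], by linarith [ht.2]⟩ ((critSet_add_int k).2 hc))
      rwa [e, e, ← h.1.deriv_add_int x k] at this)
    (fun p hp => by
      rcases h.local_form hp with ⟨s, φ, r, η, F', L, hn⟩ | ⟨r, η, F', L, ht⟩
      · obtain ⟨N, hN⟩ := exists_nat_gt (F' / η)
        have hr := hn.tame.r_pos
        refine ⟨N, ?_⟩
        filter_upwards [Ioo_mem_nhds (show p - r < p by linarith)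
          (show p < p + r by linarith)] with x hx l m h1 h2 h3
        have hpc : p ∈ critSet C := (h.deriv_eq_zero_iff p).1 hn.crit
        have h4 : deriv f x ≥ 0 := h.1.deriv_nonneg x
        rcases le_total p x with h5 | h5
        · have h6 : p < l := by
            by_contra h6
            exact h3 p ⟨not_lt.1 h6, h5.trans h2⟩ hpc
          refine (min_le_left _ _).trans ?_
          refine (hn.deriv_le_of_between hx ⟨by linarith, by linarith [hx.2]⟩
            (Or.inl ⟨h6.le, h1⟩)).trans ?_
          gcongr
        · have h6 : m < p := by
            by_contra h6
            exact h3 p ⟨h1.trans h5, not_lt.1 h6⟩ hpc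
          refine (min_le_right _ _).trans ?_
          refine (hn.deriv_le_of_between hx ⟨by linarith [hx.1], by linarith⟩
            (Or.inr ⟨h2, h6.le⟩)).trans ?_
          gcongr
      · obtain ⟨N, hN⟩ := exists_nat_gt (F / η)
        have hr := ht.r_pos
        have hη := ht.η_pos
        refine ⟨N, ?_⟩
        filter_upwards [Ioo_mem_nhds (show p - r < p by linarith)
          (show p < p + r by linarith)] with x hx l m h1 h2 h3
        calc _ ≤ F := (min_le_left _ _).trans (hF l)
          _ = F / η * η := by field_simp
          _ ≤ N * deriv f x := by
            have := ht.lower x hx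
            gcongr)
  exact ⟨N + 1, by positivity, fun l x m h1 h2 h3 => (hN x l m h1 h2 h3).trans
    (mul_le_mul_of_nonneg_right (by linarith) (h.1.deriv_nonneg x))⟩

theorem exists_short_crossBound (h : IsMulticriticalLift f C dc) :
    ∃ N : ℕ, ∀ a b c d, a < b → b < c → c < d → d - a < 1 / (N + 1 : ℝ) →
      (∀ t ∈ Icc a d, t ∉ critSet C) → CrossBound f (Real.exp (-(N * (d - a)))) a b c d := by
  obtain ⟨N, hN⟩ := exists_uniform
    (fun x N => ∀ a b c d, a < b → b < c → c < d → a ≤ x → x ≤ d → d - a < 1 / (N + 1 : ℝ) →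
      (∀ t ∈ Icc a d, t ∉ critSet C) → CrossBound f (Real.exp (-(N * (d - a)))) a b c d)
    (fun x N M hNM hx a b c d h1 h2 h3 h4 h5 h6 h7 => by
      have hNM' : (N : ℝ) ≤ M := by exact_mod_cast hNM
      have := hx a b c d h1 h2 h3 h4 h5 (h6.trans_le (by gcongr)) h7
      refine this.mono ?_ h1 h2 h3 (h.1.mono h1) (h.1.mono h3)
      have : 0 ≤ d - a := by linarith
      gcongr)
    (fun x N k hx a b c d h1 h2 h3 h4 h5 h6 h7 => by
      have := hx (a - k) (b - k) (c - k) (d - k) (by linarith) (by linarith) (by linarith)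
        (by linarith) (by linarith) (by rwa [sub_sub_sub_cancel_right]) (fun t ht hc => by
        refine h7 (t + k) ⟨by linarith [ht.1], by linarith [ht.2]⟩ ((critSet_add_int k).2 hc))
      have e : ∀ z, f (z - k) = f z - k := fun z => by
        have := h.1.map_add_int (z - k) k
        rw [sub_add_cancel] at this; linarith
      simpa only [CrossBound, e, sub_sub_sub_cancel_right] using this)
    (fun p hp => by
      have key : ∃ r > 0, ∃ B : ℝ, 0 ≤ B ∧ ∀ a b c d, p - r < a → d < p + r → a < b → b < c →
          c < d → (∀ t ∈ Icc a d, t ∉ critSet C) →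
          CrossBound f (Real.exp (-(B * (d - a)))) a b c d := by
        rcases h.local_form hp with ⟨s, φ, r, η, F, L, hn⟩ | ⟨r, η, F, L, ht⟩
        · refine ⟨r, hn.tame.r_pos, 2 * L, by linarith [hn.tame.L_nonneg],
            fun a b c d ha hd h1 h2 h3 h4 => hn.crossBound ha hd h1 h2 h3 ?_⟩
          by_contra hcon
          rw [not_or, not_lt, not_lt] at hcon
          exact h4 p hcon ((h.deriv_eq_zero_iff p).1 hn.crit)
        · exact ⟨r, ht.r_pos, 2 * L, by linarith [ht.L_nonneg],
            fun a b c d ha hd h1 h2 h3 h4 => ht.crossBound ha hd h1 h2 h3⟩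
      obtain ⟨r, hr, B, hB0, hB⟩ := key
      obtain ⟨N₁, hN₁⟩ := exists_nat_gt B
      obtain ⟨N₂, hN₂⟩ := exists_nat_gt (2 / r)
      refine ⟨max N₁ N₂, ?_⟩
      filter_upwards [Ioo_mem_nhds (show p - r / 2 < p by linarith)
        (show p < p + r / 2 by linarith)] with x hx a b c d h1 h2 h3 h4 h5 h6 h7
      have hb : B ≤ ((max N₁ N₂ : ℕ) : ℝ) := by push_cast; exact hN₁.le.trans (le_max_left _ _)
      have hy' : d - a < r / 2 := by
        refine h6.trans_le ?_
        rw [div_le_iff₀ (by positivity)]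
        have : (2 / r) ≤ ((max N₁ N₂ : ℕ) : ℝ) := by
          push_cast; exact hN₂.le.trans (le_max_right _ _)
        have h2 : r / 2 * (2 / r) = 1 := by field_simp
        nlinarith
      refine (hB a b c d (by linarith [hx.1]) (by linarith [hx.2]) h1 h2 h3 h7).mono ?_ h1 h2 h3
        (h.1.mono h1) (h.1.mono h3)
      have : 0 ≤ d - a := by linarith
      gcongr)
  exact ⟨N, fun a b c d h1 h2 h3 h4 h5 =>
    hN a a b c d h1 h2 h3 le_rfl (h1.trans (h2.trans h3)).le h4 h5⟩

end IsMulticriticalLift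

/-- `g` increases the cross-ratio `|L||R| / (|L ∪ M||M ∪ R|)` by at most the factor `B`. -/
def RatioBound (g : ℝ → ℝ) (B a b c d : ℝ) : Prop :=
  (g b - g a) * (g d - g c) * ((c - a) * (d - b)) ≤
    B * ((g c - g a) * (g d - g b) * ((b - a) * (d - c)))

theorem CrossBound.ratioBound {g : ℝ → ℝ} {θ B a b c d : ℝ} (h : CrossBound g θ a b c d)
    (hB : 1 ≤ B) (hθ : 1 ≤ B * θ) (h1 : a < b) (h2 : b < c) (h3 : c < d)
    (g1 : g a < g b) (g2 : g b < g c) (g3 : g c < g d) : RatioBound g B a b c d := by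
  unfold RatioBound CrossBound at *
  have e1 := sub_pos.2 h1; have e2 := sub_pos.2 h2; have e3 := sub_pos.2 h3
  have k1 := sub_pos.2 g1; have k2 := sub_pos.2 g2; have k3 := sub_pos.2 g3
  have e4 : 0 < d - a := by linarith
  have i1 : (g b - g a) * (g d - g c) * ((c - b) * (d - a)) ≤
      B * ((g c - g b) * (g d - g a) * ((b - a) * (d - c))) := by
    calc (g b - g a) * (g d - g c) * ((c - b) * (d - a))
        ≤ B * θ * ((g b - g a) * (g d - g c) * ((c - b) * (d - a))) :=
          le_mul_of_one_le_left (by positivity) hθ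
      _ = B * (θ * ((g b - g a) * (g d - g c) * ((c - b) * (d - a)))) := by ring
      _ ≤ _ := by gcongr
  have i2 : (g b - g a) * (g d - g c) * ((b - a) * (d - c)) ≤
      B * ((g b - g a) * (g d - g c) * ((b - a) * (d - c))) :=
    le_mul_of_one_le_left (by positivity) hB
  calc (g b - g a) * (g d - g c) * ((c - a) * (d - b))
      = (g b - g a) * (g d - g c) * ((c - b) * (d - a)) +
        (g b - g a) * (g d - g c) * ((b - a) * (d - c)) := by ring
    _ ≤ _ := add_le_add i1 i2
    _ = _ := by ring

theorem RatioBound.comp {g h : ℝ → ℝ} {B₁ B₂ a b c d : ℝ} (hg : RatioBound g B₁ a b c d)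
    (hh : RatioBound h B₂ (g a) (g b) (g c) (g d)) (hB2 : 0 ≤ B₂)
    (h1 : a < b) (h2 : b < c) (h3 : c < d)
    (g1 : g a < g b) (g2 : g b < g c) (g3 : g c < g d)
    (k1 : h (g a) < h (g b)) (k2 : h (g b) < h (g c)) (k3 : h (g c) < h (g d)) :
    RatioBound (fun x => h (g x)) (B₂ * B₁) a b c d := by
  have key : ∀ X0 X1 X2 Y0 Y1 Y2 : ℝ, 0 < X0 → 0 < X1 → 0 < X2 → 0 < Y0 → 0 < Y1 → 0 < Y2 →
      X1 * Y0 ≤ B₁ * (Y1 * X0) →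
      X2 * Y1 ≤ B₂ * (Y2 * X1) → X2 * Y0 ≤ B₂ * B₁ * (Y2 * X0) := by
    intro X0 X1 X2 Y0 Y1 Y2 x0 x1 x2 y0 y1 y2 hg hh
    have e1 := mul_le_mul_of_nonneg_left hg (mul_nonneg hB2 y2.le)
    have e2 := mul_le_mul_of_nonneg_right hh y0.le
    refine le_of_mul_le_mul_right ?_ y1
    linarith
  refine key _ _ _ _ _ _ ?_ ?_ ?_ ?_ ?_ ?_ hg hh <;> apply mul_pos <;> linarith

theorem RatioBound.mono {g : ℝ → ℝ} {B B' a b c d : ℝ} (hg : RatioBound g B a b c d)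
    (h : B ≤ B') (h1 : a < b) (h3 : c < d)
    (g1 : g a < g b) (g2 : g b < g c) (g3 : g c < g d) : RatioBound g B' a b c d := by
  refine hg.trans ?_
  have : 0 ≤ (g c - g a) * (g d - g b) * ((b - a) * (d - c)) := by
    refine (mul_pos (mul_pos ?_ ?_) (mul_pos ?_ ?_)).le <;> linarith
  exact mul_le_mul_of_nonneg_right h this

namespace IsMulticriticalLift

variable {f : ℝ → ℝ} {C : Finset ℝ} {dc : ℝ → ℝ}

theorem exists_deriv_mul_le' (h : IsMulticriticalLift f C dc) :
    ∃ A : ℝ, 0 < A ∧ ∀ u x v, u ≤ x → x ≤ v → v - u ≤ 4 →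
      deriv f x * (v - u) ≤ A * (f v - f u) := by
  obtain ⟨A, hA, hf⟩ := h.exists_deriv_mul_le
  refine ⟨2 * A, by positivity, fun u x v h1 h2 h3 => ?_⟩
  have m1 := h.1.mono.monotone h1
  have m2 := h.1.mono.monotone h2
  have d0 := h.1.deriv_nonneg x
  have i1 := hf x u (by rw [abs_le]; constructor <;> linarith)
  have i2 := hf x v (by rw [abs_le]; constructor <;> linarith)
  rw [abs_of_nonpos (by linarith), abs_of_nonpos (by linarith)] at i1
  rw [abs_of_nonneg (by linarith), abs_of_nonneg (by linarith)] at i2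
  nlinarith

theorem exists_ratioBound (h : IsMulticriticalLift f C dc) :
    ∃ B : ℝ, 1 ≤ B ∧ ∀ a b c d, a < b → b < c → c < d → d - a ≤ 4 → RatioBound f B a b c d := by
  obtain ⟨A, hA, hf⟩ := h.exists_deriv_mul_le'
  refine ⟨max 1 (A * A), le_max_left _ _, fun a b c d h1 h2 h3 h4 => ?_⟩
  have g1 := h.1.mono h1; have g2 := h.1.mono h2; have g3 := h.1.mono h3
  suffices RatioBound f (A * A) a b c d from this.mono (le_max_right _ _) h1 h3 g1 g2 g3
  obtain ⟨x, hx, ex⟩ := slope_eq h1 fun t _ => h.1.differentiableAt t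
  obtain ⟨y, hy, ey⟩ := slope_eq h3 fun t _ => h.1.differentiableAt t
  have i1 := hf a x c hx.1.le (by linarith [hx.2]) (by linarith)
  have i2 := hf b y d (by linarith [hy.1]) hy.2.le (by linarith)
  have d1 := h.1.deriv_nonneg x
  have d2 := h.1.deriv_nonneg y
  unfold RatioBound
  have := mul_le_mul i1 i2 (mul_nonneg d2 (by linarith)) (mul_nonneg hA.le (by linarith))
  have := mul_le_mul_of_nonneg_right this
    (mul_nonneg (sub_pos.2 h1).le (sub_pos.2 h3).le)
  rw [ex, ey]
  linarith

theorem exists_crossBound (h : IsMulticriticalLift f C dc) :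
    ∃ K : ℝ, 0 ≤ K ∧ ∀ a b c d, a < b → b < c → c < d → d - a ≤ 4 →
      (∀ t ∈ Icc a d, t ∉ critSet C) → CrossBound f (Real.exp (-(K * (d - a)))) a b c d := by
  obtain ⟨A, hA, hf⟩ := h.exists_deriv_mul_le'
  obtain ⟨A', hA', hf'⟩ := h.exists_min_deriv_le
  obtain ⟨N, hN⟩ := h.exists_short_crossBound
  refine ⟨N + (N + 1) * |Real.log (A * A')|, by positivity, fun a b c d h1 h2 h3 h4 hcr => ?_⟩
  have g1 := h.1.mono h1; have g2 := h.1.mono h2; have g3 := h.1.mono h3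
  rcases lt_or_ge (d - a) (1 / (N + 1 : ℝ)) with hs | hl
  · refine (hN a b c d h1 h2 h3 hs hcr).mono (Real.exp_le_exp.2 (neg_le_neg ?_)) h1 h2 h3 g1 g3
    refine mul_le_mul_of_nonneg_right ?_ (by linarith)
    have : 0 ≤ (N + 1) * |Real.log (A * A')| := by positivity
    linarith
  · have key : Real.exp (-((N + (N + 1) * |Real.log (A * A')|) * (d - a))) * (A * A') ≤ 1 := by
      have : A * A' ≤ Real.exp ((N + (N + 1) * |Real.log (A * A')|) * (d - a)) := by
        rw [← Real.log_le_iff_le_exp (by positivity)]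
        have : 1 ≤ (N + 1) * (d - a) := by rwa [div_le_iff₀' (by positivity)] at hl
        have h0 := abs_nonneg (Real.log (A * A'))
        calc Real.log (A * A') ≤ |Real.log (A * A')| := le_abs_self _
          _ ≤ (N + 1) * (d - a) * |Real.log (A * A')| := le_mul_of_one_le_left h0 this
          _ ≤ _ := by
            have : (0:ℝ) ≤ N * (d - a) := mul_nonneg (by positivity) (by linarith)
            linarith
      rw [Real.exp_neg]
      rw [inv_mul_le_iff₀ (Real.exp_pos _)]
      linarith
    set θ := Real.exp (-((N + (N + 1) * |Real.log (A * A')|) * (d - a))) with hθ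
    have hθ0 : 0 < θ := Real.exp_pos _
    obtain ⟨x, hx, ex⟩ := slope_eq h1 fun t _ => h.1.differentiableAt t
    obtain ⟨z, hz, ez⟩ := slope_eq h2 fun t _ => h.1.differentiableAt t
    obtain ⟨y, hy, ey⟩ := slope_eq h3 fun t _ => h.1.differentiableAt t
    have i1 := hf a x d hx.1.le (by linarith [hx.2]) h4
    have i2 := hf a y d (by linarith [hy.1]) hy.2.le h4
    have i3 := hf' x z y (by linarith [hx.2, hz.1]) (by linarith [hy.1, hz.2])
      (fun t ht => hcr t ⟨by linarith [hx.1, ht.1], by linarith [hy.2, ht.2]⟩)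
    have d1 := h.1.deriv_nonneg x
    have d2 := h.1.deriv_nonneg y
    have d3 := h.1.deriv_nonneg z
    have P : 0 < (b - a) * (d - c) * (c - b) :=
      mul_pos (mul_pos (by linarith) (by linarith)) (by linarith)
    have Q : deriv f x * deriv f y * (d - a) ≤ A * A' * (deriv f z * (f d - f a)) := by
      rcases min_le_iff.1 i3 with i | i
      · calc deriv f x * deriv f y * (d - a) = deriv f x * (deriv f y * (d - a)) := by ring
          _ ≤ A' * deriv f z * (A * (f d - f a)) := by
            refine mul_le_mul i i2 (mul_nonneg d2 (by linarith)) (by positivity)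
          _ = _ := by ring
      · calc deriv f x * deriv f y * (d - a) = deriv f y * (deriv f x * (d - a)) := by ring
          _ ≤ A' * deriv f z * (A * (f d - f a)) := by
            refine mul_le_mul i i1 (mul_nonneg d1 (by linarith)) (by positivity)
          _ = _ := by ring
    have W : 0 ≤ deriv f z * (f d - f a) := mul_nonneg d3 (by linarith)
    have Q' : θ * (deriv f x * deriv f y * (d - a)) ≤ deriv f z * (f d - f a) := by
      have := mul_le_mul_of_nonneg_left Q hθ0.le
      have := mul_le_mul_of_nonneg_right key W
      linarith
    have := mul_le_mul_of_nonneg_right Q' P.le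
    unfold CrossBound
    rw [ex, ey, ez]
    linarith

theorem exists_powerLaw (h : IsMulticriticalLift f C dc) {c : ℝ} (hc : c ∈ C) :
    ∃ s k₁ k₂ : ℝ, 1 < s ∧ 0 < k₁ ∧ 0 < k₂ ∧ ∀ x, |x - c| ≤ 1 →
      k₁ * |x - c| ^ s ≤ |f x - f c| ∧ |f x - f c| ≤ k₂ * |x - c| ^ s := by
  obtain ⟨s, φ, r, η, F, L, hn⟩ := h.exists_normalForm hc
  have hs0 : 0 < s := by linarith [hn.one_lt]
  have hη := hn.tame.η_pos
  have hF := hn.tame.F_pos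
  have hr := hn.tame.r_pos
  have loc : ∀ x ∈ Ioo (c - r) (c + r), η ^ s * |x - c| ^ s ≤ |f x - f c| ∧
      |f x - f c| ≤ F ^ s * |x - c| ^ s := by
    intro x hx
    rw [hn.eq x hx, add_sub_cancel_left, abs_oddPow hn.one_lt,
      ← Real.mul_rpow hη.le (abs_nonneg _), ← Real.mul_rpow hF.le (abs_nonneg _)]
    have : η * |x - c| ≤ |φ x| ∧ |φ x| ≤ F * |x - c| := by
      rcases lt_trichotomy x c with l | l | l
      · have i1 := hn.tame.lin_lower hx hn.tame.mem_p l
        have i2 := hn.tame.lin_upper hx hn.tame.mem_p l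
        rw [hn.zero] at i1 i2
        have : 0 < η * (c - x) := mul_pos hη (by linarith)
        rw [abs_of_neg (by linarith : x - c < 0), abs_of_neg (by linarith : φ x < 0)]
        constructor <;> linarith
      · subst l; simp [hn.zero]
      · have i1 := hn.tame.lin_lower hn.tame.mem_p hx l
        have i2 := hn.tame.lin_upper hn.tame.mem_p hx l
        rw [hn.zero] at i1 i2
        have : 0 < η * (x - c) := mul_pos hη (by linarith)
        rw [abs_of_pos (by linarith : 0 < x - c), abs_of_pos (by linarith : 0 < φ x)]
        constructor <;> linarith
    exact ⟨Real.rpow_le_rpow (by positivity) this.1 hs0.le,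
      Real.rpow_le_rpow (by positivity) this.2 hs0.le⟩
  have hr2 : 0 < r / 2 := by positivity
  have hq : 0 < (r / 2) ^ s := by positivity
  refine ⟨s, min (η ^ s) (η ^ s * (r / 2) ^ s), max (F ^ s) (1 / (r / 2) ^ s), hn.one_lt,
    lt_min (by positivity) (by positivity), lt_max_of_lt_left (by positivity), fun x hx => ?_⟩
  have hx0 : 0 ≤ |x - c| ^ s := by positivity
  by_cases hxr : |x - c| < r
  · obtain ⟨h1, h2⟩ := loc x (by rw [abs_lt] at hxr; constructor <;> linarith [hxr.1, hxr.2])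
    exact ⟨(mul_le_mul_of_nonneg_right (min_le_left _ _) hx0).trans h1,
      h2.trans (mul_le_mul_of_nonneg_right (le_max_left _ _) hx0)⟩
  · push Not at hxr
    have hx1 : |x - c| ^ s ≤ 1 := Real.rpow_le_one (abs_nonneg _) hx hs0.le
    have hx2 : (r / 2) ^ s ≤ |x - c| ^ s := Real.rpow_le_rpow hr2.le (by linarith) hs0.le
    constructor
    · have far : η ^ s * (r / 2) ^ s ≤ |f x - f c| := by
        rcases le_total c x with l | l
        · rw [abs_of_nonneg (by linarith : 0 ≤ x - c)] at hxr
          have h1 := (loc (c + r / 2) ⟨by linarith, by linarith⟩).1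
          have m1 := h.1.mono.monotone (show c + r / 2 ≤ x by linarith)
          have m2 := h.1.mono (show c < c + r / 2 by linarith)
          rw [add_sub_cancel_left, abs_of_pos hr2, abs_of_pos (by linarith)] at h1
          rw [abs_of_nonneg (by linarith)]; linarith
        · rw [abs_of_nonpos (by linarith : x - c ≤ 0)] at hxr
          have h1 := (loc (c - r / 2) ⟨by linarith, by linarith⟩).1
          have m1 := h.1.mono.monotone (show x ≤ c - r / 2 by linarith)
          have m2 := h.1.mono (show c - r / 2 < c by linarith)
          rw [show c - r / 2 - c = -(r / 2) by ring, abs_neg, abs_of_pos hr2,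
            abs_of_neg (by linarith)] at h1
          rw [abs_of_nonpos (by linarith)]; linarith
      calc _ ≤ η ^ s * (r / 2) ^ s * |x - c| ^ s :=
            mul_le_mul_of_nonneg_right (min_le_right _ _) hx0
        _ ≤ η ^ s * (r / 2) ^ s * 1 := by gcongr
        _ ≤ _ := by linarith
    · have h1 : |f x - f c| ≤ 1 := by
        rw [abs_le] at hx ⊢
        have m1 := h.1.mono.monotone (show x ≤ c + 1 by linarith)
        have m2 := h.1.mono.monotone (show c ≤ x + 1 by linarith)
        rw [h.1.periodic] at m1 m2
        constructor <;> linarith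
      calc |f x - f c| ≤ 1 := h1
        _ ≤ 1 / (r / 2) ^ s * |x - c| ^ s := by
          rw [one_div, inv_mul_eq_div, le_div_iff₀ hq]; linarith
        _ ≤ _ := mul_le_mul_of_nonneg_right (le_max_right _ _) hx0

end IsMulticriticalLift

section Arithmetic

variable {ρ : ℝ}

/-- The signed displacement `qₙ ρ - pₙ` of the `n`-th closest return. -/
def disp (ρ : ℝ) (n : ℕ) : ℝ := qden ρ n * ρ - pnum ρ n

theorem irrational_gauss_iterate (hρ : Irrational ρ) (n : ℕ) :
    Irrational (gaussMap^[n] (Int.fract ρ)) ∧ gaussMap^[n] (Int.fract ρ) ∈ Ioo (0 : ℝ) 1 := by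
  have fr : ∀ x : ℝ, Irrational x → Irrational (Int.fract x) ∧ Int.fract x ∈ Ioo (0 : ℝ) 1 := by
    intro x hx
    have h1 : Irrational (Int.fract x) := by rw [Int.fract]; exact hx.sub_intCast _
    exact ⟨h1, (Int.fract_nonneg x).lt_of_ne h1.ne_zero.symm, Int.fract_lt_one x⟩
  induction n with
  | zero => exact fr ρ hρ
  | succ n ih =>
    rw [Function.iterate_succ_apply']
    exact fr _ ih.1.inv

theorem gauss_inv (hρ : Irrational ρ) (n : ℕ) :
    (gaussMap^[n] (Int.fract ρ))⁻¹ = cfA ρ n + gaussMap^[n + 1] (Int.fract ρ) := by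
  rw [Function.iterate_succ_apply', cfA, gaussMap]
  have := (irrational_gauss_iterate hρ n).2.1
  have h : 0 ≤ (gaussMap^[n] (Int.fract ρ))⁻¹ := inv_nonneg.2 this.le
  rw [natCast_floor_eq_intCast_floor h, Int.floor_add_fract]

theorem one_le_cfA (hρ : Irrational ρ) (n : ℕ) : 1 ≤ cfA ρ n := by
  have h := (irrational_gauss_iterate hρ n).2
  rw [cfA, Nat.le_floor_iff (inv_nonneg.2 h.1.le)]
  simpa using (one_le_inv₀ h.1).2 h.2.le

theorem one_le_qden (hρ : Irrational ρ) (n : ℕ) : 1 ≤ qden ρ n ∧ qden ρ n ≤ qden ρ (n + 1) := by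
  induction n with
  | zero => exact ⟨by simp [qden], by simpa [qden] using one_le_cfA hρ 0⟩
  | succ n ih =>
    refine ⟨ih.1.trans ih.2, ?_⟩
    have := Nat.mul_le_mul_right (qden ρ (n + 1)) (one_le_cfA hρ (n + 1))
    rw [show qden ρ (n + 1 + 1) = cfA ρ (n + 1) * qden ρ (n + 1) + qden ρ n from rfl]
    omega

theorem disp_succ (hρ : Irrational ρ) (h1 : ρ ∈ Ioo (0 : ℝ) 1) (n : ℕ) :
    disp ρ (n + 1) = -(gaussMap^[n + 1] (Int.fract ρ)) * disp ρ n := by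
  induction n with
  | zero =>
    have h := gauss_inv hρ 0
    have hf : Int.fract ρ = ρ := Int.fract_eq_self.2 ⟨h1.1.le, h1.2⟩
    rw [Function.iterate_zero, id, hf] at h
    have : ((cfA ρ 0 : ℕ) : ℝ) = ρ⁻¹ - gaussMap^[0 + 1] (Int.fract ρ) := by rw [hf]; linarith
    simp only [disp, qden, pnum, this]
    have := h1.1.ne'
    field_simp
    push_cast; ring
  | succ n ih =>
    have h := gauss_inv hρ (n + 1)
    have h0 := (irrational_gauss_iterate hρ (n + 1)).2.1.ne'
    have e : disp ρ (n + 2) = cfA ρ (n + 1) * disp ρ (n + 1) + disp ρ n := by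
      simp only [disp, qden, pnum]; push_cast; ring
    have : disp ρ n = -(gaussMap^[n + 1] (Int.fract ρ))⁻¹ * disp ρ (n + 1) := by
      rw [ih]; field_simp
    rw [e, this, h]; ring

theorem disp_sign (hρ : Irrational ρ) (h1 : ρ ∈ Ioo (0 : ℝ) 1) (n : ℕ) :
    0 < (-1) ^ n * disp ρ n ∧ (-1) ^ n * disp ρ n < 1 := by
  induction n with
  | zero => simpa [disp, qden, pnum] using h1
  | succ n ih =>
    rw [disp_succ hρ h1, pow_succ]
    have h := (irrational_gauss_iterate hρ (n + 1)).2
    have e : (-1 : ℝ) ^ n * -1 * (-gaussMap^[n + 1] (Int.fract ρ) * disp ρ n) =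
      gaussMap^[n + 1] (Int.fract ρ) * ((-1) ^ n * disp ρ n) := by ring
    rw [e]
    exact ⟨mul_pos h.1 ih.1, by nlinarith [h.1, h.2, ih.1, ih.2]⟩

theorem abs_disp_succ_lt (hρ : Irrational ρ) (h1 : ρ ∈ Ioo (0 : ℝ) 1) (n : ℕ) :
    |disp ρ (n + 1)| < |disp ρ n| := by
  have h := (irrational_gauss_iterate hρ (n + 1)).2
  have h0 : disp ρ n ≠ 0 := fun e => by simpa [e] using (disp_sign hρ h1 n).1
  rw [disp_succ hρ h1, abs_mul, abs_neg, abs_of_pos h.1]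
  have := abs_pos.2 h0
  nlinarith [h.2]

theorem qden_pnum_det (n : ℕ) :
    (pnum ρ n : ℤ) * qden ρ (n + 1) - pnum ρ (n + 1) * qden ρ n = (-1) ^ (n + 1) := by
  induction n with
  | zero => simp [qden, pnum]
  | succ n ih =>
    rw [show qden ρ (n + 1 + 1) = cfA ρ (n + 1) * qden ρ (n + 1) + qden ρ n from rfl,
      show pnum ρ (n + 1 + 1) = cfA ρ (n + 1) * pnum ρ (n + 1) + pnum ρ n from rfl]
    rw [pow_succ, ← ih]
    push_cast
    ring

theorem abs_disp_le (hρ : Irrational ρ) (h1 : ρ ∈ Ioo (0 : ℝ) 1) (n l : ℕ) (m : ℤ)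
    (hl : 0 < l) (hl' : l < qden ρ (n + 1)) : |disp ρ n| ≤ |l * ρ - m| := by
  set q : ℤ := (qden ρ n : ℤ) with hq
  set q' : ℤ := (qden ρ (n + 1) : ℤ) with hq'
  set p : ℤ := (pnum ρ n : ℤ) with hp
  set p' : ℤ := (pnum ρ (n + 1) : ℤ) with hp'
  have det : p * q' - p' * q = (-1) ^ (n + 1) := qden_pnum_det n
  obtain ⟨u, v, hu, hv⟩ : ∃ u v : ℤ, (l : ℤ) = u * q + v * q' ∧ m = u * p + v * p' := by
    refine ⟨(-1) ^ (n + 1) * (m * q' - l * p'), (-1) ^ (n + 1) * (l * p - m * q), ?_, ?_⟩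
    · have : ((-1 : ℤ) ^ (n + 1)) * (-1) ^ (n + 1) = 1 := by rw [← mul_pow]; simp
      linear_combination (-(l : ℤ)) * this + (-(-1) ^ (n + 1) * (l : ℤ)) * det
    · have : ((-1 : ℤ) ^ (n + 1)) * (-1) ^ (n + 1) = 1 := by rw [← mul_pow]; simp
      linear_combination (-m) * this + (-(-1) ^ (n + 1) * m) * det
  have e : (l : ℝ) * ρ - m = u * disp ρ n + v * disp ρ (n + 1) := by
    have hu' : (l : ℝ) = u * qden ρ n + v * qden ρ (n + 1) := by exact_mod_cast hu
    have hv' : (m : ℝ) = u * pnum ρ n + v * pnum ρ (n + 1) := by exact_mod_cast hv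
    rw [hu', hv', disp, disp]; ring
  have q0 : 1 ≤ q := by rw [hq]; exact_mod_cast (one_le_qden hρ n).1
  have q1 : 1 ≤ q' := by rw [hq']; exact_mod_cast (one_le_qden hρ (n + 1)).1
  have hl0 : (0 : ℤ) < l := by exact_mod_cast hl
  have hl1 : (l : ℤ) < q' := by rw [hq']; exact_mod_cast hl'
  have hg := (irrational_gauss_iterate hρ (n + 1)).2.1
  rw [e, disp_succ hρ h1]
  have e2 : (u : ℝ) * disp ρ n + v * (-gaussMap^[n + 1] (Int.fract ρ) * disp ρ n) =
    (u - v * gaussMap^[n + 1] (Int.fract ρ)) * disp ρ n := by ring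
  rw [e2, abs_mul]
  refine le_mul_of_one_le_left (abs_nonneg _) ?_
  rcases lt_trichotomy v 0 with h | h | h
  · have : 0 < u := by
      by_contra hc
      have : u * q ≤ 0 := mul_nonpos_of_nonpos_of_nonneg (by omega) (by omega)
      have : v * q' ≤ 0 := mul_nonpos_of_nonpos_of_nonneg (by omega) (by omega)
      omega
    have hu1 : (1 : ℝ) ≤ u := by exact_mod_cast this
    have hv1 : (v : ℝ) < 0 := by exact_mod_cast h
    rw [le_abs]; left; nlinarith
  · subst h
    have : u ≠ 0 := by rintro rfl; simp at hu; omega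
    simp only [Int.cast_zero, zero_mul, sub_zero]
    exact_mod_cast Int.one_le_abs this
  · have : u < 0 := by
      by_contra hc
      have : 0 ≤ u * q := mul_nonneg (by omega) (by omega)
      have : q' ≤ v * q' := le_mul_of_one_le_left (by omega) (by omega)
      omega
    have hu1 : (u : ℝ) ≤ -1 := by exact_mod_cast (by omega : u ≤ -1)
    have hv1 : (0 : ℝ) < v := by exact_mod_cast h
    rw [le_abs]; right; nlinarith

end Arithmetic

/-- `f` is a continuous degree one lift whose orbits are ordered like those of the
rotation by `ρ`. -/
structure Dyn (f : ℝ → ℝ) (ρ : ℝ) : Prop where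
  mono : StrictMono f
  cont : Continuous f
  periodic : ∀ x, f (x + 1) = f x + 1
  ord : ∀ (x : ℝ) (i j : ℕ) (m : ℤ), f^[i] x < f^[j] x + m ↔ i * ρ < j * ρ + m

theorem IsCircleMapLift.dyn {f : ℝ → ℝ} {ρ : ℝ} (h : IsCircleMapLift f) (hr : HasRotNumber f ρ)
    (hρ : Irrational ρ) : Dyn f ρ := by
  refine ⟨h.mono, h.smooth.continuous, h.periodic, ?_⟩
  let F : CircleDeg1Lift := ⟨⟨f, h.mono.monotone⟩, h.periodic⟩
  have hF : ⇑F = f := rfl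
  have hFk : ∀ k : ℕ, ⇑(F ^ k) = f^[k] := fun k => by rw [CircleDeg1Lift.coe_pow, hF]
  have hτ : CircleDeg1Lift.translationNumber F = ρ := by
    refine tendsto_nhds_unique ?_ hr
    have := F.tendsto_translationNumber 0
    simpa [hFk] using this
  have hτk : ∀ k : ℕ, CircleDeg1Lift.translationNumber (F ^ k) = k * ρ := fun k => by
    rw [CircleDeg1Lift.translationNumber_pow, hτ]
  have up : ∀ (k : ℕ) (x : ℝ) (m : ℤ), f^[k] x ≤ x + m → k * ρ ≤ m := by
    intro k x m hx
    rw [← hτk]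
    refine le_of_tendsto ((F ^ k).tendsto_translationNumber x) ?_
    filter_upwards [eventually_gt_atTop 0] with n hn
    have := (F ^ k).iterate_le_of_map_le_add_int (by rw [hFk]; exact hx) n
    rw [← CircleDeg1Lift.coe_pow] at this
    rw [div_le_iff₀ (by exact_mod_cast hn)]
    linarith
  have dn : ∀ (k : ℕ) (x : ℝ) (m : ℤ), x + m ≤ f^[k] x → m ≤ k * ρ := by
    intro k x m hx
    rw [← hτk]
    refine ge_of_tendsto ((F ^ k).tendsto_translationNumber x) ?_
    filter_upwards [eventually_gt_atTop 0] with n hn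
    have := (F ^ k).le_iterate_of_add_int_le_map (by rw [hFk]; exact hx) n
    rw [← CircleDeg1Lift.coe_pow] at this
    rw [le_div_iff₀ (by exact_mod_cast hn)]
    linarith
  have ne : ∀ (k : ℕ) (m : ℤ), k ≠ 0 → (k : ℝ) * ρ ≠ m := fun k m hk =>
    (hρ.natCast_mul hk).ne_int m
  have key : ∀ (k : ℕ) (x : ℝ) (m : ℤ), (f^[k] x < x + m ↔ k * ρ < m) ∧
      (x + m < f^[k] x ↔ m < k * ρ) := by
    intro k x m
    rcases eq_or_ne k 0 with rfl | hk
    · simp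
    · refine ⟨⟨fun hx => (up k x m hx.le).lt_of_ne (ne k m hk), fun hx => ?_⟩,
        ⟨fun hx => (dn k x m hx.le).lt_of_ne (ne k m hk).symm, fun hx => ?_⟩⟩
      · by_contra hc; exact absurd (dn k x m (not_lt.1 hc)) (not_le.2 hx)
      · by_contra hc; exact absurd (up k x m (not_lt.1 hc)) (not_le.2 hx)
  intro x i j m
  rcases le_total j i with hij | hij
  · obtain ⟨k, rfl⟩ := Nat.exists_eq_add_of_le' hij
    rw [Function.iterate_add_apply, (key k _ m).1]
    push_cast
    constructor <;> intro <;> linarith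
  · obtain ⟨k, rfl⟩ := Nat.exists_eq_add_of_le' hij
    rw [Function.iterate_add_apply]
    have := (key k (f^[i] x) (-m)).2
    push_cast at this ⊢
    rw [← sub_lt_iff_lt_add, sub_eq_add_neg, this]
    constructor <;> intro <;> linarith

/-- The return map `x ↦ f^q x - p`. -/
def ret (f : ℝ → ℝ) (q : ℕ) (p : ℤ) (x : ℝ) : ℝ := f^[q] x - p

namespace Dyn

variable {f : ℝ → ℝ} {ρ : ℝ}

theorem iterate_add_int (h : Dyn f ρ) (k : ℕ) (x : ℝ) (m : ℤ) : f^[k] (x + m) = f^[k] x + m := by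
  let F : CircleDeg1Lift := ⟨⟨f, h.mono.monotone⟩, h.periodic⟩
  have : ⇑(F ^ k) = f^[k] := by rw [CircleDeg1Lift.coe_pow]; rfl
  rw [← this, CircleDeg1Lift.map_add_int]

theorem surj_iterate (h : Dyn f ρ) (k : ℕ) : Function.Surjective f^[k] := by
  let F : CircleDeg1Lift := ⟨⟨f, h.mono.monotone⟩, h.periodic⟩
  exact (h.cont.surjective F.tendsto_atTop F.tendsto_atBot).iterate k

theorem ord_int (h : Dyn f ρ) (x : ℝ) (i j : ℕ) (a b : ℤ) :
    f^[i] x + a < f^[j] x + b ↔ i * ρ + a < j * ρ + b := by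
  have := h.ord x i j (b - a)
  push_cast at this
  constructor <;> intro h1
  · have := this.1 (by linarith); linarith
  · have := this.2 (by linarith); linarith

theorem ret_eq (q : ℕ) (p : ℤ) (x : ℝ) : ret f q p x = f^[q] x + ((-p : ℤ) : ℝ) := by
  rw [ret]; push_cast; ring

theorem iterate_ret (h : Dyn f ρ) (k q : ℕ) (p : ℤ) (x : ℝ) :
    f^[k] (ret f q p x) = ret f q p (f^[k] x) := by
  rw [ret_eq, ret_eq, h.iterate_add_int, ← Function.iterate_add_apply,
    ← Function.iterate_add_apply, add_comm k]

theorem ret_ret (h : Dyn f ρ) (q q' : ℕ) (p p' : ℤ) (x : ℝ) :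
    ret f q p (ret f q' p' x) = ret f (q + q') (p + p') x := by
  rw [ret_eq, ret_eq, ret_eq, h.iterate_add_int, ← Function.iterate_add_apply]
  push_cast; ring

theorem ret_comm (h : Dyn f ρ) (q q' : ℕ) (p p' : ℤ) (x : ℝ) :
    ret f q p (ret f q' p' x) = ret f q' p' (ret f q p x) := by
  rw [h.ret_ret, h.ret_ret, add_comm q, add_comm p]

theorem ret_add_int (h : Dyn f ρ) (q : ℕ) (p : ℤ) (x : ℝ) (m : ℤ) :
    ret f q p (x + m) = ret f q p x + m := by
  rw [ret, ret, h.iterate_add_int]; ring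

theorem strictMono_ret (h : Dyn f ρ) (q : ℕ) (p : ℤ) : StrictMono (ret f q p) :=
  fun _ _ hxy => sub_lt_sub_right (h.mono.iterate q hxy) _

theorem surj_ret (h : Dyn f ρ) (q : ℕ) (p : ℤ) : Function.Surjective (ret f q p) := by
  intro y
  obtain ⟨x, hx⟩ := h.surj_iterate q (y + p)
  exact ⟨x, by rw [ret, hx]; ring⟩

theorem continuous_ret (h : Dyn f ρ) (q : ℕ) (p : ℤ) : Continuous (ret f q p) :=
  (h.cont.iterate q).sub continuous_const

theorem ret_lt_ret_add_int (h : Dyn f ρ) (q q' : ℕ) (p p' m : ℤ) (x : ℝ) :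
    ret f q p x < ret f q' p' x + m ↔ q * ρ - p < q' * ρ - p' + m := by
  have := h.ord_int x q q' (-p) (-p' + m)
  rw [ret_eq, ret_eq]
  push_cast at this ⊢
  rw [show f^[q'] x + -(p' : ℝ) + m = f^[q'] x + (-(p' : ℝ) + m) by ring, this]
  rw [← add_assoc]; rfl

theorem lt_ret (h : Dyn f ρ) {q : ℕ} {p : ℤ} (x : ℝ) (h0 : 0 < q * ρ - p) : x < ret f q p x := by
  have := (h.ret_lt_ret_add_int 0 q 0 p 0 x).2 (by simpa using h0)
  simpa [ret] using this

theorem ret_lt (h : Dyn f ρ) {q : ℕ} {p : ℤ} (x : ℝ) (h0 : q * ρ - p < 0) : ret f q p x < x := by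
  have := (h.ret_lt_ret_add_int q 0 p 0 0 x).2 (by simpa using h0)
  simpa [ret] using this

theorem ret_lt_add_one (h : Dyn f ρ) {q : ℕ} {p : ℤ} (x : ℝ) (h0 : q * ρ - p < 1) :
    ret f q p x < x + 1 := by
  have := (h.ret_lt_ret_add_int q 0 p 0 1 x).2 (by simpa using h0)
  simpa [ret] using this

theorem iterate_lt (h : Dyn f ρ) (k : ℕ) {x y : ℝ} (hxy : x < y) : f^[k] x < f^[k] y :=
  h.mono.iterate k hxy

end Dyn

/-- `(q, p)` and `(q', p')` are consecutive convergents of `ρ`, the first one from below. -/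
structure Level (ρ : ℝ) (q q' : ℕ) (p p' : ℤ) : Prop where
  pos : 0 < q * ρ - p
  lt_one : q * ρ - p < 1
  neg : q' * ρ - p' < 0
  sum_pos : 0 < (q * ρ - p) + (q' * ρ - p')
  one_le : 1 ≤ q
  le : q ≤ q'
  best : ∀ (l : ℕ) (m : ℤ), 0 < l → l < q' → q * ρ - p ≤ |l * ρ - m|

namespace Dyn

variable {f : ℝ → ℝ} {ρ : ℝ} {q q' : ℕ} {p p' : ℤ}

theorem disjoint_images (h : Dyn f ρ) (hl : Level ρ q q' p p') (u : ℝ) {i j : ℕ} (hi : i < q')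
    (hj : j < q') {x : ℝ} {m : ℤ} (h1 : x ∈ Ico (f^[i] u) (f^[i] (ret f q p u)))
    (h2 : x + m ∈ Ico (f^[j] u) (f^[j] (ret f q p u))) : i = j ∧ m = 0 := by
  have key : ∀ i j : ℕ, ∀ x : ℝ, ∀ m : ℤ, i ≤ j → j < q' →
      x ∈ Ico (f^[i] u) (f^[i] (ret f q p u)) →
      x + m ∈ Ico (f^[j] u) (f^[j] (ret f q p u)) → i = j ∧ m = 0 := by
    intro i j x m hij hj h1 h2
    rw [ret_eq, h.iterate_add_int, ← Function.iterate_add_apply] at h1 h2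
    have e1 : f^[j] u + ((-m : ℤ) : ℝ) < f^[i + q] u + ((-p : ℤ) : ℝ) := by
      have := h1.2; have := h2.1; push_cast at *; linarith
    have e2 : f^[i] u + (m : ℝ) < f^[j + q] u + ((-p : ℤ) : ℝ) := by
      have := h1.1; have := h2.2; linarith
    rw [h.ord_int] at e1 e2
    push_cast at e1 e2
    obtain ⟨k, rfl⟩ := Nat.exists_eq_add_of_le hij
    push_cast at e1 e2
    have e3 : |k * ρ - m| < q * ρ - p := by rw [abs_lt]; constructor <;> linarith
    rcases Nat.eq_zero_or_pos k with rfl | hk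
    · refine ⟨rfl, ?_⟩
      have : |(m : ℝ)| < 1 := by
        have := hl.lt_one
        simp at e3; linarith
      have : |m| < 1 := by exact_mod_cast this
      exact Int.abs_lt_one_iff.1 this
    · exact absurd e3 (not_lt.2 (hl.best k m hk (by omega)))
  rcases le_total i j with hij | hij
  · exact key i j x m hij hj h1 h2
  · have := key j i (x + m) (-m) hij hi h2 (by push_cast; simpa using h1)
    exact ⟨this.1.symm, by simpa using this.2⟩

theorem sum_length_le (h : Dyn f ρ) (hl : Level ρ q q' p p') (u : ℝ) :
    ∑ i ∈ Finset.range q', (f^[i] (ret f q p u) - f^[i] u) ≤ 2 := by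
  classical
  let J : ℕ → Set ℝ := fun i =>
    Ico (f^[i] u - ⌊f^[i] u⌋) (f^[i] (ret f q p u) - ⌊f^[i] u⌋)
  have hlt : ∀ i, f^[i] u < f^[i] (ret f q p u) := fun i => h.iterate_lt i (h.lt_ret u hl.pos)
  have hlt1 : ∀ i, f^[i] (ret f q p u) < f^[i] u + 1 := fun i => by
    rw [h.iterate_ret]; exact h.ret_lt_add_one _ hl.lt_one
  have hvol : ∀ i, MeasureTheory.volume (J i) =
      ENNReal.ofReal (f^[i] (ret f q p u) - f^[i] u) := fun i => by
    rw [Real.volume_Ico]; congr 1; ring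
  have hdis : Set.PairwiseDisjoint (↑(Finset.range q')) J := by
    intro i hi j hj hij
    rw [Function.onFun, Set.disjoint_left]
    intro x h1 h2
    refine hij (h.disjoint_images hl u (Finset.mem_range.1 hi) (Finset.mem_range.1 hj)
      (x := x + ⌊f^[i] u⌋) (m := -⌊f^[i] u⌋ + ⌊f^[j] u⌋) ?_ ?_).1
    · exact ⟨by linarith [h1.1], by linarith [h1.2]⟩
    · push_cast; exact ⟨by linarith [h2.1], by linarith [h2.2]⟩
  have hsub : (⋃ i ∈ Finset.range q', J i) ⊆ Ico (0 : ℝ) 2 := by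
    refine iUnion₂_subset fun i _ x hx => ⟨?_, ?_⟩
    · have := Int.floor_le (f^[i] u); linarith [hx.1]
    · have := Int.lt_floor_add_one (f^[i] u); linarith [hx.2, hlt1 i]
  have := MeasureTheory.measure_mono (μ := MeasureTheory.volume) hsub
  rw [MeasureTheory.measure_biUnion_finset hdis (fun i _ => measurableSet_Ico)] at this
  simp only [hvol] at this
  rw [← ENNReal.ofReal_sum_of_nonneg (fun i _ => (sub_pos.2 (hlt i)).le), Real.volume_Ico,
    ENNReal.ofReal_le_ofReal_iff (by norm_num)] at this
  linarith

open Classical in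
theorem card_crit_le (h : Dyn f ρ) (hl : Level ρ q q' p p') (C : Finset ℝ) (u : ℝ) :
    ((Finset.range q').filter fun i =>
      ∃ x ∈ Ico (f^[i] u) (f^[i] (ret f q p u)), x ∈ critSet C).card ≤ C.card := by
  have : ∀ i ∈ (Finset.range q').filter fun i =>
      ∃ x ∈ Ico (f^[i] u) (f^[i] (ret f q p u)), x ∈ critSet C,
      ∃ c ∈ C, ∃ k : ℤ, c + k ∈ Ico (f^[i] u) (f^[i] (ret f q p u)) := by
    intro i hi
    obtain ⟨x, hx, c, hc, k, rfl⟩ := (Finset.mem_filter.1 hi).2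
    exact ⟨c, hc, k, hx⟩
  choose! c hc k hk using this
  refine Finset.card_le_card_of_injOn c hc ?_
  intro i hi j hj hij
  have h1 := hk i hi
  have h2 := hk j hj
  rw [← hij] at h2
  refine (h.disjoint_images hl u (Finset.mem_range.1 (Finset.mem_filter.1 hi).1)
    (Finset.mem_range.1 (Finset.mem_filter.1 hj).1) h1 (m := k j - k i) ?_).1
  push_cast
  convert h2 using 1; ring

/-- The orbit segment of length `q + q'` of any point visits every fundamental domain
of the return map. -/
theorem exists_hit (h : Dyn f ρ) (hl : Level ρ q q' p p') (x z : ℝ) :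
    ∃ k < q + q', ∃ l : ℤ, z ≤ f^[k] x + l ∧ f^[k] x + l < ret f q p z := by
  let L : ℕ → ℤ := fun k => ⌈z - f^[k] x⌉ - 1
  have hL : ∀ k, f^[k] x + L k < z := fun k => by
    have := Int.ceil_lt_add_one (z - f^[k] x)
    simp only [L]; push_cast; linarith
  have hL' : ∀ k (l : ℤ), f^[k] x + l < z → l ≤ L k := fun k l hh => by
    have : l < ⌈z - f^[k] x⌉ := Int.lt_ceil.2 (by linarith)
    simp only [L]; omega
  obtain ⟨k, hk, hmax⟩ := Finset.exists_max_image (Finset.range (q + q'))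
    (fun k => f^[k] x + L k) ⟨0, Finset.mem_range.2 (by have := hl.one_le; omega)⟩
  rw [Finset.mem_range] at hk
  have hmax' : ∀ k' < q + q', ∀ l : ℤ, f^[k] x + L k < f^[k'] x + l → z ≤ f^[k'] x + l := by
    intro k' hk' l hlt
    by_contra hc
    have h1 : (l : ℝ) ≤ L k' := by exact_mod_cast hL' k' l (not_le.1 hc)
    have h2 := hmax k' (Finset.mem_range.2 hk')
    linarith
  set W := f^[k] x + L k with hW
  have e1 : ret f q p W = f^[k + q] x + ((L k - p : ℤ) : ℝ) := by
    rw [hW, h.ret_add_int, ret, add_comm k, Function.iterate_add_apply]; push_cast; ring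
  have hWz : ret f q p W < ret f q p z := h.strictMono_ret q p (hL k)
  rcases lt_or_ge k q' with hkq | hkq
  · refine ⟨k + q, by omega, L k - p, ?_, ?_⟩
    · exact hmax' _ (by omega) _ (by rw [← e1]; exact h.lt_ret W hl.pos)
    · rw [← e1]; exact hWz
  · obtain ⟨j, rfl⟩ := Nat.exists_eq_add_of_le' hkq
    set V := f^[j] x + ((L (j + q') + p' : ℤ) : ℝ) with hV
    have e2 : W = ret f q' p' V := by
      rw [hV, h.ret_add_int, ret, hW, add_comm j, Function.iterate_add_apply]; push_cast; ring
    refine ⟨j, by omega, L (j + q') + p', ?_, ?_⟩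
    · refine hmax' _ (by omega) _ ?_
      rw [← hV, e2]; exact h.ret_lt V hl.neg
    · rw [← hV]
      refine lt_trans ?_ hWz
      rw [e2, h.ret_ret]
      refine h.lt_ret V ?_
      have := hl.sum_pos
      push_cast; linarith

end Dyn

/-- A degree one lift ordered like a rotation, whose distortion of cross-ratios is
controlled by the length away from the critical set and by a constant near it. -/
structure Reg (f : ℝ → ℝ) (ρ : ℝ) (C : Finset ℝ) (K A : ℝ) : Prop extends Dyn f ρ where
  K_nonneg : 0 ≤ K
  one_le_A : 1 ≤ A
  ratio : ∀ a b c d, a < b → b < c → c < d → d - a ≤ 4 → RatioBound f A a b c d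
  ratio_exp : ∀ a b c d, a < b → b < c → c < d → d - a ≤ 4 →
    (∀ t ∈ Icc a d, t ∉ critSet C) → RatioBound f (Real.exp (K * (d - a))) a b c d

/-- The distortion of cross-ratios along a first return. -/
def returnDist (C : Finset ℝ) (K A : ℝ) : ℝ := A ^ (4 * C.card) * Real.exp (K * 8)

namespace Reg

variable {f : ℝ → ℝ} {ρ K A : ℝ} {C : Finset ℝ} {q q' : ℕ} {p p' : ℤ}

theorem one_le_returnDist (h : Reg f ρ C K A) : 1 ≤ returnDist C K A :=
  one_le_mul_of_one_le_of_one_le (one_le_pow₀ h.one_le_A)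
    (Real.one_le_exp (mul_nonneg h.K_nonneg (by norm_num)))

theorem ratioBound_iterate (h : Reg f ρ C K A) (hl : Level ρ q q' p p') {w a b c d : ℝ}
    (hw : w ≤ a) (hab : a < b) (hbc : b < c) (hcd : c < d)
    (hd : d ≤ ret f q p (ret f q p (ret f q p w))) {k : ℕ} (hk : k ≤ q') :
    RatioBound f^[k] (returnDist C K A) a b c d := by
  classical
  let D := h.toDyn
  let G := ret f q p
  let u : ℕ → ℝ := fun r => G^[r] w
  have hu : ∀ r, u (r + 1) = ret f q p (u r) := fun r => by
    simp only [u, Function.iterate_succ_apply', G]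
  have u0 : u 0 = w := rfl
  have u3 : d ≤ u 3 := by rw [hu, hu, hu, u0]; exact hd
  have hlt : ∀ i r, f^[i] (u r) < f^[i] (u (r + 1)) := fun i r => by
    rw [hu]; exact D.iterate_lt i (D.lt_ret _ hl.pos)
  have hlt1 : ∀ i r, f^[i] (u (r + 1)) < f^[i] (u r) + 1 := fun i r => by
    rw [hu, D.iterate_ret]; exact D.ret_lt_add_one _ hl.lt_one
  have mona : ∀ i, f^[i] (u 0) ≤ f^[i] a := fun i => (D.mono.iterate i).monotone hw
  have mond : ∀ i, f^[i] d ≤ f^[i] (u 3) := fun i => (D.mono.iterate i).monotone u3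
  let bad : ℕ → Prop := fun i => ∃ x ∈ Ico (f^[i] (u 0)) (f^[i] (u 4)), x ∈ critSet C
  let e : ℕ → ℝ := fun i => (if bad i then A else 1) * Real.exp (K * (f^[i] d - f^[i] a))
  have A0 : 0 ≤ A := by linarith [h.one_le_A]
  have e0 : ∀ i, 0 ≤ e i := fun i => by
    simp only [e]; split_ifs <;> positivity
  have step : ∀ k, RatioBound f^[k] (∏ i ∈ Finset.range k, e i) a b c d := by
    intro k
    induction k with
    | zero => simp [RatioBound]; linarith
    | succ k ih =>
      rw [Finset.prod_range_succ, mul_comm, Function.iterate_succ']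
      have g1 := D.iterate_lt k hab
      have g2 := D.iterate_lt k hbc
      have g3 := D.iterate_lt k hcd
      have hlen : f^[k] d - f^[k] a ≤ 4 := by
        linarith [mona k, mond k, hlt1 k 0, hlt1 k 1, hlt1 k 2]
      refine ih.comp (h := f) ?_ (e0 k) hab hbc hcd g1 g2 g3 (D.mono g1) (D.mono g2) (D.mono g3)
      by_cases hb : bad k
      · refine (h.ratio _ _ _ _ g1 g2 g3 hlen).mono ?_ g1 g3 (D.mono g1) (D.mono g2) (D.mono g3)
        simp only [e, if_pos hb]
        refine le_mul_of_one_le_right A0 (Real.one_le_exp ?_)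
        exact mul_nonneg h.K_nonneg (by linarith)
      · simp only [e, if_neg hb, one_mul]
        refine h.ratio_exp _ _ _ _ g1 g2 g3 hlen fun t ht htc => hb ⟨t, ⟨?_, ?_⟩, htc⟩
        · linarith [ht.1, mona k]
        · linarith [ht.2, mond k, hlt k 3]
  refine (step k).mono ?_ hab hcd (D.iterate_lt k hab) (D.iterate_lt k hbc) (D.iterate_lt k hcd)
  have sumle : ∑ i ∈ Finset.range q', (f^[i] (u 4) - f^[i] (u 0)) ≤ 8 := by
    have e4 : ∀ i, f^[i] (u 4) - f^[i] (u 0) = (f^[i] (ret f q p (u 0)) - f^[i] (u 0)) +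
        (f^[i] (ret f q p (u 1)) - f^[i] (u 1)) + (f^[i] (ret f q p (u 2)) - f^[i] (u 2)) +
        (f^[i] (ret f q p (u 3)) - f^[i] (u 3)) := fun i => by
      rw [← hu, ← hu, ← hu, ← hu]; ring
    simp only [e4, Finset.sum_add_distrib]
    linarith [D.sum_length_le hl (u 0), D.sum_length_le hl (u 1), D.sum_length_le hl (u 2),
      D.sum_length_le hl (u 3)]
  have cardle : ((Finset.range q').filter bad).card ≤ 4 * C.card := by
    let S : ℕ → Finset ℕ := fun r => (Finset.range q').filter fun i =>
      ∃ x ∈ Ico (f^[i] (u r)) (f^[i] (ret f q p (u r))), x ∈ critSet C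
    have hS : ∀ r, (S r).card ≤ C.card := fun r => by
      convert D.card_crit_le hl C (u r)
    have : (Finset.range q').filter bad ⊆ S 0 ∪ S 1 ∪ S 2 ∪ S 3 := by
      intro i hi
      obtain ⟨hi, x, hx, hxc⟩ := Finset.mem_filter.1 hi
      have hS : ∀ r, f^[i] (u r) ≤ x → x < f^[i] (u (r + 1)) → i ∈ S r := fun r h1 h2 =>
        Finset.mem_filter.2 ⟨hi, x, ⟨h1, by rw [← hu]; exact h2⟩, hxc⟩
      simp only [Finset.mem_union]
      rcases lt_or_ge x (f^[i] (u 1)) with h1 | h1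
      · exact .inl (.inl (.inl (hS 0 hx.1 h1)))
      rcases lt_or_ge x (f^[i] (u 2)) with h2 | h2
      · exact .inl (.inl (.inr (hS 1 h1 h2)))
      rcases lt_or_ge x (f^[i] (u 3)) with h3 | h3
      · exact .inl (.inr (hS 2 h2 h3))
      · exact .inr (hS 3 h3 hx.2)
    refine (Finset.card_le_card this).trans ?_
    refine (Finset.card_union_le _ _).trans ?_
    have := Finset.card_union_le (S 0 ∪ S 1) (S 2)
    have := Finset.card_union_le (S 0) (S 1)
    have := hS 0; have := hS 1; have := hS 2; have := hS 3
    omega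
  have e1 : ∀ i, 1 ≤ e i := fun i => by
    refine one_le_mul_of_one_le_of_one_le (by split_ifs <;> simp [h.one_le_A])
      (Real.one_le_exp (mul_nonneg h.K_nonneg ?_))
    linarith [D.iterate_lt i hab, D.iterate_lt i hbc, D.iterate_lt i hcd]
  calc ∏ i ∈ Finset.range k, e i ≤ ∏ i ∈ Finset.range q', e i :=
        monotone_nat_of_le_succ (f := fun k => ∏ i ∈ Finset.range k, e i) (fun n => by
          rw [Finset.prod_range_succ]
          exact le_mul_of_one_le_right (Finset.prod_nonneg fun i _ => e0 i) (e1 n)) hk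
    _ = A ^ ((Finset.range q').filter bad).card *
        Real.exp (K * ∑ i ∈ Finset.range q', (f^[i] d - f^[i] a)) := by
      simp only [e]
      rw [Finset.prod_mul_distrib, ← Real.exp_sum, Finset.mul_sum]
      congr 1
      rw [Finset.prod_ite]; simp
    _ ≤ _ := by
      refine mul_le_mul (pow_le_pow_right₀ h.one_le_A cardle) ?_ (by positivity)
        (by positivity)
      refine Real.exp_le_exp.2 (mul_le_mul_of_nonneg_left (le_trans ?_ sumle) h.K_nonneg)
      refine Finset.sum_le_sum fun i _ => ?_
      linarith [mona i, mond i, hlt i 3]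

end Reg

/-- Bound for the ratio of lengths of adjacent fundamental domains of a return map. -/
def adjConst (C : Finset ℝ) (K A : ℝ) : ℝ :=
  returnDist C K A ^ 2 * (2 * returnDist C K A + 2) ^ 2

namespace Dyn

variable {f : ℝ → ℝ} {ρ : ℝ}

theorem exists_min_displacement (h : Dyn f ρ) (q : ℕ) (p : ℤ) :
    ∃ z, ∀ x, ret f q p z - z ≤ ret f q p x - x := by
  obtain ⟨z, -, hz⟩ := isCompact_Icc.exists_isMinOn (s := Icc (0 : ℝ) 1) ⟨0, by simp⟩
    ((h.continuous_ret q p).sub continuous_id).continuousOn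
  refine ⟨z, fun x => ?_⟩
  have := hz ⟨Int.fract_nonneg x, (Int.fract_lt_one x).le⟩
  simp only [id, mem_ofPred_eq, Pi.sub_apply] at this
  have e : ret f q p x = ret f q p (Int.fract x) + ⌊x⌋ := by
    rw [← h.ret_add_int, Int.fract_add_floor]
  have := Int.fract_add_floor x
  linarith

end Dyn

namespace Reg

variable {f : ℝ → ℝ} {ρ K A : ℝ} {C : Finset ℝ} {q q' : ℕ} {p p' : ℤ}

theorem one_le_adjConst (h : Reg f ρ C K A) : 1 ≤ adjConst C K A := by
  have := h.one_le_returnDist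
  exact one_le_mul_of_one_le_of_one_le (one_le_pow₀ this) (one_le_pow₀ (by linarith))

theorem exists_min_adjacent (h : Reg f ρ C K A) (hl : Level ρ q q' p p') :
    ∃ z₁ μ : ℝ, 0 < μ ∧ (∀ x, μ ≤ ret f q p x - x) ∧
      ret f q p (ret f q p z₁) - z₁ ≤ (2 * returnDist C K A + 1) * μ := by
  have D := h.toDyn
  obtain ⟨z, hz⟩ := D.exists_min_displacement q p
  obtain ⟨z₁, h1⟩ := D.surj_ret q p z
  obtain ⟨z₂, h2⟩ := D.surj_ret q p z₁
  refine ⟨z₁, ret f q p z - z, sub_pos.2 (D.lt_ret z hl.pos), hz, ?_⟩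
  have p0 := D.lt_ret z hl.pos
  have p1 := D.lt_ret z₁ hl.pos
  have p2 := D.lt_ret z₂ hl.pos
  have p3 := D.lt_ret (ret f q p z) hl.pos
  have hB := h.one_le_returnDist
  have key := h.ratioBound_iterate hl le_rfl (h2 ▸ p2) (h1 ▸ p1) p0
    (show ret f q p z ≤ ret f q p (ret f q p (ret f q p z₂)) by rw [h2, h1]) hl.le
  have b1 := hz z₂
  have b2 := hz z₁
  have b3 := hz (ret f q p z)
  have e : ∀ x, f^[q] x = ret f q p x + p := fun x => by rw [ret]; ring
  unfold RatioBound at key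
  rw [e, e, e, e, h2, h1] at key
  rw [h1] at p1 b2 ⊢
  rw [h2] at p2 b1
  set B := returnDist C K A
  obtain ⟨a, ha⟩ : ∃ a, a = z₁ - z₂ := ⟨_, rfl⟩
  obtain ⟨b, hb⟩ : ∃ b, b = z - z₁ := ⟨_, rfl⟩
  obtain ⟨μ, hμ⟩ : ∃ μ, μ = ret f q p z - z := ⟨_, rfl⟩
  obtain ⟨ε, hε⟩ : ∃ ε, ε = ret f q p (ret f q p z) - ret f q p z := ⟨_, rfl⟩
  rw [← hμ] at b1 b2 b3 ⊢
  rw [← ha] at b1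
  rw [← hb] at b2
  rw [← hε] at b3
  have μ0 : 0 < μ := by linarith
  have key' : b * ε * ((a + b) * (b + μ)) ≤ B * ((b + μ) * (μ + ε) * (a * μ)) := by
    rw [ha, hb, hμ, hε]
    convert key using 2 <;> ring
  have k2 : b * ε * (a + b) ≤ B * ((μ + ε) * (a * μ)) := by
    refine le_of_mul_le_mul_right ?_ (by linarith : 0 < b + μ)
    linarith
  have k3 : b ≤ 2 * B * μ := by
    have i1 : ε * a * b ≤ b * ε * (a + b) := by
      have : 0 ≤ b * ε * b := by
        have : 0 ≤ ε := by linarith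
        have : 0 ≤ b := by linarith
        positivity
      linarith
    have i2 : B * ((μ + ε) * (a * μ)) ≤ B * ((ε + ε) * (a * μ)) := by
      have : 0 ≤ a * μ := mul_nonneg (by linarith) μ0.le
      gcongr
    have : 0 < ε * a := mul_pos (by linarith) (by linarith)
    refine le_of_mul_le_mul_left ?_ this
    linarith
  linarith

/-- Adjacent fundamental domains of a return map are comparable. -/
theorem adjacent_comparable (h : Reg f ρ C K A) (hl : Level ρ q q' p p') (w : ℝ) :
    ret f q p (ret f q p w) - ret f q p w ≤ adjConst C K A * (ret f q p w - w) ∧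
    ret f q p (ret f q p w) - ret f q p w ≤
      adjConst C K A * (ret f q p (ret f q p (ret f q p w)) - ret f q p (ret f q p w)) := by
  have D := h.toDyn
  obtain ⟨z, μ, hμ0, hμ, hz⟩ := h.exists_min_adjacent hl
  have hB := h.one_le_returnDist
  obtain ⟨k, hk, l, hk1, hk2⟩ := D.exists_hit hl (ret f q p w) z
  have w1 := D.lt_ret w hl.pos
  have w2 := D.lt_ret (ret f q p w) hl.pos
  have w3 := D.lt_ret (ret f q p (ret f q p w)) hl.pos
  obtain ⟨k₁, k₂, hk₁, hk₂, rfl⟩ : ∃ k₁ k₂, k₁ ≤ q' ∧ k₂ ≤ q' ∧ k = k₂ + k₁ := by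
    have := hl.le
    rcases le_total k q' with hh | hh
    · exact ⟨k, 0, hh, by omega, by omega⟩
    · exact ⟨q', k - q', le_rfl, by omega, by omega⟩
  have r1 := h.ratioBound_iterate hl le_rfl w1 w2 w3 le_rfl hk₁
  have r2 := h.ratioBound_iterate hl (w := f^[k₁] w) le_rfl (D.iterate_lt k₁ w1)
    (D.iterate_lt k₁ w2) (D.iterate_lt k₁ w3) (by simp only [D.iterate_ret]; exact le_rfl) hk₂
  have r := r1.comp r2 (by linarith) w1 w2 w3 (D.iterate_lt k₁ w1)
    (D.iterate_lt k₁ w2) (D.iterate_lt k₁ w3) (D.iterate_lt k₂ (D.iterate_lt k₁ w1))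
    (D.iterate_lt k₂ (D.iterate_lt k₁ w2)) (D.iterate_lt k₂ (D.iterate_lt k₁ w3))
  simp only [← Function.iterate_add_apply] at r
  set v := f^[k₂ + k₁] w + l with hv
  have e0 : f^[k₂ + k₁] w = v - l := by rw [hv]; ring
  have e1 : f^[k₂ + k₁] (ret f q p w) = ret f q p v - l := by
    rw [D.iterate_ret, hv, D.ret_add_int]; ring
  have e2 : f^[k₂ + k₁] (ret f q p (ret f q p w)) = ret f q p (ret f q p v) - l := by
    rw [D.iterate_ret, D.iterate_ret, hv, D.ret_add_int, D.ret_add_int]; ring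
  have e3 : f^[k₂ + k₁] (ret f q p (ret f q p (ret f q p w))) =
      ret f q p (ret f q p (ret f q p v)) - l := by
    rw [D.iterate_ret, D.iterate_ret, D.iterate_ret, hv, D.ret_add_int, D.ret_add_int,
      D.ret_add_int]; ring
  unfold RatioBound at r
  beta_reduce at r
  rw [e0, e1, e2, e3] at r
  rw [e1] at hk1 hk2
  have hk3 : ret f q p (ret f q p v) < ret f q p (ret f q p z) :=
    D.strictMono_ret q p (by linarith)
  have m1 := hμ v
  have m2 := hμ (ret f q p v)
  have m3 := hμ (ret f q p (ret f q p v))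
  set B := returnDist C K A with hBdef
  obtain ⟨L, hL⟩ : ∃ L, L = ret f q p v - v := ⟨_, rfl⟩
  obtain ⟨M, hM⟩ : ∃ M, M = ret f q p (ret f q p v) - ret f q p v := ⟨_, rfl⟩
  obtain ⟨R, hR⟩ : ∃ R, R = ret f q p (ret f q p (ret f q p v)) - ret f q p (ret f q p v) :=
    ⟨_, rfl⟩
  obtain ⟨L', hL'⟩ : ∃ L, L = ret f q p w - w := ⟨_, rfl⟩
  obtain ⟨M', hM'⟩ : ∃ M, M = ret f q p (ret f q p w) - ret f q p w := ⟨_, rfl⟩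
  obtain ⟨R', hR'⟩ : ∃ R, R = ret f q p (ret f q p (ret f q p w)) - ret f q p (ret f q p w) :=
    ⟨_, rfl⟩
  have r' : L * R * ((L' + M') * (M' + R')) ≤ B * B * ((L + M) * (M + R) * (L' * R')) := by
    rw [hL, hM, hR, hL', hM', hR']
    convert r using 2 <;> ring
  have hML : M ≤ (2 * B + 1) * μ := by linarith
  rw [← hL', ← hM', ← hR']
  have L'0 : 0 < L' := by linarith
  have M'0 : 0 < M' := by linarith
  have R'0 : 0 < R' := by linarith
  rw [← hL] at m1
  rw [← hM] at m2
  rw [← hR] at m3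
  clear_value B
  clear r1 r2 r e0 e1 e2 e3 hL hM hR hL' hM' hR' hk1 hk2 hk3 hμ hz w1 w2 w3 hv
  have l1 : L + M ≤ (2 * B + 2) * L := by
    have := mul_le_mul_of_nonneg_left m1 (by linarith : 0 ≤ 2 * B + 1)
    linarith
  have l2 : M + R ≤ (2 * B + 2) * R := by
    have := mul_le_mul_of_nonneg_left m3 (by linarith : 0 ≤ 2 * B + 1)
    linarith
  have hX : (L' + M') * (M' + R') ≤ adjConst C K A * (L' * R') := by
    have : 0 < L * R := mul_pos (by linarith) (by linarith)
    refine le_of_mul_le_mul_left ?_ this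
    calc L * R * ((L' + M') * (M' + R')) ≤ B * B * ((L + M) * (M + R) * (L' * R')) := r'
      _ ≤ B * B * (((2 * B + 2) * L) * ((2 * B + 2) * R) * (L' * R')) := by
        have : 0 ≤ L' * R' := by positivity
        have : 0 ≤ M + R := by linarith
        have : 0 ≤ (2 * B + 2) * L := mul_nonneg (by linarith) (by linarith)
        gcongr
      _ = _ := by rw [adjConst, ← hBdef]; ring
  have hN := h.one_le_adjConst
  constructor
  · refine le_of_mul_le_mul_right ?_ (by linarith : 0 < M' + R')
    have : adjConst C K A * (L' * R') ≤ adjConst C K A * (L' * (M' + R')) := by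
      gcongr; linarith
    have : 0 < L' * (M' + R') := by positivity
    linarith
  · refine le_of_mul_le_mul_right ?_ (by linarith : 0 < L' + M')
    have : adjConst C K A * (L' * R') ≤ adjConst C K A * ((L' + M') * R') := by
      gcongr; linarith
    have : 0 < (L' + M') * R' := by positivity
    linarith

end Reg

/-- Relative length of the space around the images of a fundamental domain at a
critical point. -/
def spaceConst (C : Finset ℝ) (K A s k₁ k₂ : ℝ) : ℝ :=
  (k₁ / (6 * returnDist C K A * adjConst C K A ^ 4 * k₂)) ^ (1 / (s - 1)) /
    (6 * returnDist C K A * adjConst C K A ^ 4)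

namespace Reg

variable {f : ℝ → ℝ} {ρ K A : ℝ} {C : Finset ℝ} {q q' : ℕ} {p p' : ℤ}

theorem spaceConst_pos (h : Reg f ρ C K A) {s k₁ k₂ : ℝ} (hk₁ : 0 < k₁) (hk₂ : 0 < k₂) :
    0 < spaceConst C K A s k₁ k₂ := by
  have := h.one_le_returnDist
  have := h.one_le_adjConst
  unfold spaceConst
  positivity

theorem mul_le_of_ratio {t P Q X Y m B N : ℝ} (hP : 0 < P) (hB : 0 ≤ B) (hY : 0 ≤ Y)
    (h1 : t * Q ≤ N * m * P) (ht : 0 ≤ t) (h2 : P * X ≤ B * (Q * Y)) :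
    t * X ≤ B * N * m * Y := by
  refine le_of_mul_le_mul_left ?_ hP
  calc P * (t * X) = t * (P * X) := by ring
    _ ≤ t * (B * (Q * Y)) := mul_le_mul_of_nonneg_left h2 ht
    _ = B * Y * (t * Q) := by ring
    _ ≤ B * Y * (N * m * P) := mul_le_mul_of_nonneg_left h1 (by positivity)
    _ = _ := by ring

/-- Images of `[c, G c]` have definite space on both sides, inside the images of
`[G' c, G² c]`, for all times up to the next return. -/
theorem space_le (h : Reg f ρ C K A) (hl : Level ρ q q' p p')
    (hG' : ∀ w, |ret f q' p' (ret f q' p' w) - ret f q' p' w| ≤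
        adjConst C K A * |ret f q' p' w - w| ∧
      |ret f q' p' (ret f q' p' w) - ret f q' p' w| ≤ adjConst C K A *
        |ret f q' p' (ret f q' p' (ret f q' p' w)) - ret f q' p' (ret f q' p' w)|)
    {c s k₁ k₂ : ℝ} (hs : 1 < s) (hk₁ : 0 < k₁) (hk₂ : 0 < k₂)
    (hc : ∀ x, |x - c| ≤ 1 → k₁ * |x - c| ^ s ≤ |f x - f c| ∧ |f x - f c| ≤ k₂ * |x - c| ^ s)
    {j : ℕ} (hj : j ≤ q') :
    spaceConst C K A s k₁ k₂ * (f^[j] (ret f q p c) - f^[j] c) ≤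
        f^[j] c - f^[j] (ret f q' p' c) ∧
      spaceConst C K A s k₁ k₂ * (f^[j] (ret f q p c) - f^[j] c) ≤
        f^[j] (ret f q p (ret f q p c)) - f^[j] (ret f q p c) := by
  have D := h.toDyn
  have hB := h.one_le_returnDist
  have hN := h.one_le_adjConst
  set y := ret f q' p' c with hy
  have hGy : ret f q' p' (ret f q p c) = ret f q p y := by rw [hy, D.ret_comm]
  have hGGy : ret f q' p' (ret f q p (ret f q p c)) = ret f q p (ret f q p y) := by
    rw [D.ret_comm, hGy]
  have yc : y < c := D.ret_lt c hl.neg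
  have y'y : ret f q' p' y < y := D.ret_lt y hl.neg
  have pos_sum : ∀ x, x < ret f q p (ret f q' p' x) := fun x => by
    rw [D.ret_ret]
    refine D.lt_ret x ?_
    have := hl.sum_pos
    push_cast; linarith
  have cGy : c < ret f q p y := pos_sum c
  have c1 := D.lt_ret c hl.pos
  have c2 := D.lt_ret (ret f q p c) hl.pos
  have y1 := D.lt_ret y hl.pos
  have y2 := D.lt_ret (ret f q p y) hl.pos
  have c11 := D.ret_lt_add_one c hl.lt_one
  obtain ⟨t, ht⟩ : ∃ t, t = c - y := ⟨_, rfl⟩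
  obtain ⟨m, hm⟩ : ∃ m, m = ret f q p c - c := ⟨_, rfl⟩
  obtain ⟨L, hL⟩ : ∃ L, L = y - ret f q' p' y := ⟨_, rfl⟩
  obtain ⟨M, hM⟩ : ∃ M, M = ret f q p y - y := ⟨_, rfl⟩
  obtain ⟨R, hR⟩ : ∃ R, R = ret f q p (ret f q p y) - ret f q p y := ⟨_, rfl⟩
  set B := returnDist C K A with hBdef
  set N := adjConst C K A with hNdef
  have t0 : 0 < t := by linarith
  have m0 : 0 < m := by linarith
  have L0 : 0 < L := by linarith
  have M0 : 0 < M := by linarith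
  have R0 : 0 < R := by linarith
  obtain ⟨w, hw⟩ := D.surj_ret q p c
  obtain ⟨w₂, hw₂⟩ := D.surj_ret q p w
  obtain ⟨w₃, hw₃⟩ := D.surj_ret q' p' c
  obtain ⟨w₄, hw₄⟩ := D.surj_ret q p y
  have wy : w < y := by
    have := pos_sum w
    rw [D.ret_comm, hw] at this
    exact this
  have a1 : c - w ≤ N * m := by
    have := (h.adjacent_comparable hl w₂).2
    rw [hw₂, hw] at this
    rw [hm]; exact this
  have a2 : t ≤ N * L := by
    have := (hG' w₃).2
    rw [hw₃, abs_of_neg (by linarith), abs_of_neg (by linarith)] at this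
    rw [ht, hL]; linarith
  have a3 : L ≤ N * t := by
    have := (hG' c).1
    rw [abs_of_neg (by linarith), abs_of_neg (by linarith)] at this
    rw [ht, hL]; linarith
  have a4 : M ≤ N * R := by
    have := (h.adjacent_comparable hl w₄).2
    rw [hw₄] at this
    rw [hM, hR]; exact this
  have Gyc : ret f q p y < ret f q p c := D.strictMono_ret q p yc
  have hLM : L + M ≤ 3 * N ^ 2 * m := by
    have b1 : t ≤ N * m := by linarith
    have b2 : M ≤ m + N * m := by linarith
    have b3 : N * t ≤ N * (N * m) := by gcongr
    have b4 : m ≤ N * m := le_mul_of_one_le_left m0.le hN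
    have b5 : N * m ≤ N * (N * m) := by gcongr
    linarith
  have hMR : M + R ≤ 2 * N * R := by
    have : R ≤ N * R := le_mul_of_one_le_left R0.le hN
    linarith
  have E1 : t * ((L + M) * (M + R)) ≤ 6 * N ^ 4 * m * (L * R) := by
    calc t * ((L + M) * (M + R)) ≤ (N * L) * ((3 * N ^ 2 * m) * (2 * N * R)) := by gcongr
      _ = _ := by ring
  have P0 : 0 < L * R := mul_pos L0 R0
  have ratio : ∀ j ≤ q', L * R * ((f^[j] (ret f q p c) - f^[j] y) *
      (f^[j] (ret f q p (ret f q p c)) - f^[j] c)) ≤ B * ((L + M) * (M + R) *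
      ((f^[j] c - f^[j] y) * (f^[j] (ret f q p (ret f q p c)) - f^[j] (ret f q p c)))) := by
    intro j hj
    have key := h.ratioBound_iterate hl (w := f^[j] y) le_rfl (D.iterate_lt j yc)
      (D.iterate_lt j c1) (D.iterate_lt j c2)
      (by
        simp only [← D.iterate_ret]
        exact (D.mono.iterate j).monotone ((D.strictMono_ret q p).monotone
          ((D.strictMono_ret q p).monotone cGy.le)))
      (k := q' - j) (by omega)
    have e : ∀ x, f^[q' - j] (f^[j] x) = ret f q' p' x + p' := fun x => by
      rw [← Function.iterate_add_apply, Nat.sub_add_cancel hj, ret]; ring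
    unfold RatioBound at key
    rw [e, e, e, e, hGGy, hGy, ← hy] at key
    rw [hL, hM, hR]
    convert key using 2 <;> ring
  have BN : 0 < 6 * B * N ^ 4 := by positivity
  have hr0 : (k₁ / (6 * B * N ^ 4 * k₂)) ^ (1 / (s - 1)) * m ≤ t := by
    have r1 := ratio 1 (hl.one_le.trans hl.le)
    simp only [Function.iterate_one] at r1
    have f1 := D.mono yc
    have f2 := D.mono c1
    have f3 := D.mono c2
    have Y0 : 0 < (f c - f y) * (f (ret f q p (ret f q p c)) - f (ret f q p c)) :=
      mul_pos (by linarith) (by linarith)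
    have r2 := mul_le_of_ratio P0 (by linarith) Y0.le E1 t0.le r1
    have r3 : t * (f (ret f q p c) - f c) ≤ B * (6 * N ^ 4) * m * (f c - f y) := by
      have i0 : 0 < f (ret f q p (ret f q p c)) - f c := by linarith
      refine le_of_mul_le_mul_right ?_ i0
      have i1 : t * (f (ret f q p c) - f c) ≤ t * (f (ret f q p c) - f y) := by gcongr
      have i2 : B * (6 * N ^ 4) * m *
          ((f c - f y) * (f (ret f q p (ret f q p c)) - f (ret f q p c))) ≤
          B * (6 * N ^ 4) * m * ((f c - f y) * (f (ret f q p (ret f q p c)) - f c)) := by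
        have : 0 ≤ f c - f y := by linarith
        gcongr
      have i3 := mul_le_mul_of_nonneg_right i1 i0.le
      linarith
    have yw1 : t ≤ 1 := by
      have := D.ret_lt_add_one y hl.lt_one
      linarith
    have p1 := (hc (ret f q p c) (by rw [abs_of_pos (by linarith)]; linarith)).1
    have p2 := (hc y (by rw [abs_of_neg (by linarith)]; linarith)).2
    rw [abs_of_pos (by linarith), abs_of_pos (by linarith), ← hm] at p1
    rw [abs_of_neg (by linarith), abs_of_neg (by linarith),
      show -(y - c) = t by linarith] at p2
    have r4 : t * (k₁ * m ^ s) ≤ B * (6 * N ^ 4) * m * (k₂ * t ^ s) := by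
      calc t * (k₁ * m ^ s) ≤ t * (f (ret f q p c) - f c) := by gcongr
        _ ≤ B * (6 * N ^ 4) * m * (f c - f y) := r3
        _ ≤ _ := by gcongr; linarith
    have em : m ^ s = m * m ^ (s - 1) := by
      rw [← Real.rpow_one_add' m0.le (by linarith)]; congr 1; ring
    have et : t ^ s = t * t ^ (s - 1) := by
      rw [← Real.rpow_one_add' t0.le (by linarith)]; congr 1; ring
    rw [em, et] at r4
    have r5 : k₁ * m ^ (s - 1) ≤ 6 * B * N ^ 4 * k₂ * t ^ (s - 1) := by
      have : 0 < t * m := mul_pos t0 m0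
      refine le_of_mul_le_mul_left ?_ this
      linarith
    have hs1 : 0 < s - 1 := by linarith
    have κ0 : 0 < k₁ / (6 * B * N ^ 4 * k₂) := by positivity
    rw [← Real.rpow_le_rpow_iff (by positivity) t0.le hs1, Real.mul_rpow (by positivity) m0.le,
      ← Real.rpow_mul κ0.le, one_div_mul_cancel hs1.ne', Real.rpow_one, div_mul_eq_mul_div,
      div_le_iff₀ (by positivity)]
    linarith
  obtain ⟨r, hr⟩ : ∃ r, r = (k₁ / (6 * B * N ^ 4 * k₂)) ^ (1 / (s - 1)) := ⟨_, rfl⟩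
  rw [← hr] at hr0
  have hr1 : 0 < r := by rw [hr]; positivity
  have E2 : r * ((L + M) * (M + R)) ≤ 6 * N ^ 4 * 1 * (L * R) := by
    refine le_of_mul_le_mul_left ?_ m0
    have : r * m * ((L + M) * (M + R)) ≤ t * ((L + M) * (M + R)) := by gcongr
    linarith
  have hτ : spaceConst C K A s k₁ k₂ = r / (6 * B * N ^ 4) := by rw [spaceConst, ← hr]
  rw [hτ]
  have g1 := D.iterate_lt j yc
  have g2 := D.iterate_lt j c1
  have g3 := D.iterate_lt j c2
  have key := ratio j hj
  obtain ⟨a, ha⟩ : ∃ a, a = f^[j] c - f^[j] y := ⟨_, rfl⟩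
  obtain ⟨b, hb⟩ : ∃ b, b = f^[j] (ret f q p c) - f^[j] c := ⟨_, rfl⟩
  obtain ⟨e, he⟩ : ∃ e, e = f^[j] (ret f q p (ret f q p c)) - f^[j] (ret f q p c) := ⟨_, rfl⟩
  rw [show f^[j] (ret f q p c) - f^[j] y = a + b by rw [ha, hb]; ring,
    show f^[j] (ret f q p (ret f q p c)) - f^[j] c = b + e by rw [hb, he]; ring,
    ← ha, ← he] at key
  rw [← ha, ← hb, ← he]
  have a0 : 0 < a := by linarith
  have b0 : 0 < b := by linarith
  have e0 : 0 < e := by linarith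
  have fin := mul_le_of_ratio P0 (by linarith) (by positivity) E2 hr1.le key
  constructor
  · rw [div_mul_eq_mul_div, div_le_iff₀ BN]
    refine le_of_mul_le_mul_right ?_ (by linarith : 0 < b + e)
    have : r * a * (b + e) ≥ 0 := by positivity
    have : 6 * B * N ^ 4 * (a * b) ≥ 0 := by positivity
    linarith
  · rw [div_mul_eq_mul_div, div_le_iff₀ BN]
    refine le_of_mul_le_mul_left ?_ (by linarith : 0 < a + b)
    have : r * (a + b) * e ≥ 0 := by positivity
    have : 6 * B * N ^ 4 * (b * e) ≥ 0 := by positivity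
    linarith

end Reg

/-- Conjugation by the reflection `x ↦ -x`. -/
def refl (f : ℝ → ℝ) (x : ℝ) : ℝ := -f (-x)

theorem refl_iterate (f : ℝ → ℝ) (k : ℕ) (x : ℝ) : (refl f)^[k] x = -f^[k] (-x) := by
  induction k with
  | zero => simp
  | succ k ih => rw [Function.iterate_succ_apply', ih, refl, neg_neg, Function.iterate_succ_apply']

theorem ret_refl (f : ℝ → ℝ) (q : ℕ) (p : ℤ) (x : ℝ) :
    ret (refl f) q (-p) x = -ret f q p (-x) := by
  rw [ret, ret, refl_iterate]; push_cast; ring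

theorem Dyn.refl {f : ℝ → ℝ} {ρ : ℝ} (h : Dyn f ρ) : Dyn (refl f) (-ρ) where
  mono x y hxy := neg_lt_neg (h.mono (neg_lt_neg hxy))
  cont := (h.cont.comp continuous_neg).neg
  periodic x := by
    have := h.periodic (-(x + 1))
    rw [show -(x + 1) + 1 = -x by ring] at this
    simp only [MCircle.refl]; linarith
  ord x i j m := by
    have := h.ord (-x) j i m
    rw [refl_iterate, refl_iterate]
    constructor <;> intro h1
    · have := this.1 (by linarith); linarith
    · have := this.2 (by linarith); linarith

theorem RatioBound.refl {g : ℝ → ℝ} {B a b c d : ℝ} (h : RatioBound g B (-d) (-c) (-b) (-a)) :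
    RatioBound (refl g) B a b c d := by
  simp only [RatioBound, MCircle.refl] at *
  linarith

theorem CrossBound.refl {g : ℝ → ℝ} {θ a b c d : ℝ} (h : CrossBound g θ (-d) (-c) (-b) (-a)) :
    CrossBound (refl g) θ a b c d := by
  simp only [CrossBound, MCircle.refl] at *
  linarith

theorem mem_critSet_image_neg {C : Finset ℝ} {x : ℝ} :
    x ∈ critSet (C.image Neg.neg) ↔ -x ∈ critSet C := by
  constructor
  · rintro ⟨c, hc, k, rfl⟩
    obtain ⟨b, hb, rfl⟩ := Finset.mem_image.1 hc
    exact ⟨b, hb, -k, by push_cast; ring⟩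
  · rintro ⟨c, hc, k, hk⟩
    exact ⟨-c, Finset.mem_image_of_mem _ hc, -k, by push_cast; linarith⟩

theorem card_image_neg (C : Finset ℝ) : (C.image Neg.neg).card = C.card :=
  Finset.card_image_of_injective _ neg_injective

theorem Reg.refl {f : ℝ → ℝ} {ρ K A : ℝ} {C : Finset ℝ} (h : Reg f ρ C K A) :
    Reg (refl f) (-ρ) (C.image Neg.neg) K A where
  toDyn := h.toDyn.refl
  K_nonneg := h.K_nonneg
  one_le_A := h.one_le_A
  ratio a b c d hab hbc hcd hd :=
    (h.ratio _ _ _ _ (neg_lt_neg hcd) (neg_lt_neg hbc) (neg_lt_neg hab) (by linarith)).refl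
  ratio_exp a b c d hab hbc hcd hd hC := by
    have := h.ratio_exp _ _ _ _ (neg_lt_neg hcd) (neg_lt_neg hbc) (neg_lt_neg hab) (by linarith)
      fun t ht ht' => hC (-t) ⟨by linarith [ht.2], by linarith [ht.1]⟩
        (mem_critSet_image_neg.2 (by rwa [neg_neg]))
    rw [neg_sub_neg] at this
    exact this.refl

/-- A `Reg` map that is differentiable and does not contract cross-ratios much away from the
critical set. -/
structure SmoothReg (f : ℝ → ℝ) (ρ : ℝ) (C : Finset ℝ) (K A : ℝ) : Prop extends Reg f ρ C K A where
  diff : Differentiable ℝ f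
  cross : ∀ a b c d, a < b → b < c → c < d → d - a ≤ 4 →
    (∀ t ∈ Icc a d, t ∉ critSet C) → CrossBound f (Real.exp (-(K * (d - a)))) a b c d

theorem SmoothReg.refl {f : ℝ → ℝ} {ρ K A : ℝ} {C : Finset ℝ} (h : SmoothReg f ρ C K A) :
    SmoothReg (refl f) (-ρ) (C.image Neg.neg) K A where
  toReg := h.toReg.refl
  diff := (h.diff.comp differentiable_neg).neg
  cross a b c d hab hbc hcd hd hC := by
    have := h.cross _ _ _ _ (neg_lt_neg hcd) (neg_lt_neg hbc) (neg_lt_neg hab) (by linarith)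
      fun t ht ht' => hC (-t) ⟨by linarith [ht.2], by linarith [ht.1]⟩
        (mem_critSet_image_neg.2 (by rwa [neg_neg]))
    rw [neg_sub_neg] at this
    exact this.refl

theorem IsMulticriticalLift.exists_smoothReg {f dc : ℝ → ℝ} {ρ : ℝ} {C : Finset ℝ}
    (h : IsMulticriticalLift f C dc) (hr : HasRotNumber f ρ) (hρ : Irrational ρ) :
    ∃ K A, SmoothReg f ρ C K A := by
  obtain ⟨A, hA, hA'⟩ := h.exists_ratioBound
  obtain ⟨K, hK, hK'⟩ := h.exists_crossBound
  refine ⟨K, A, { toDyn := h.1.dyn hr hρ, K_nonneg := hK, one_le_A := hA, ratio := hA',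
                  ratio_exp := fun a b c d hab hbc hcd hd hC => ?_,
                  diff := h.1.differentiableAt, cross := hK' }⟩
  refine (hK' a b c d hab hbc hcd hd hC).ratioBound (Real.one_le_exp ?_) ?_ hab hbc hcd
    (h.1.mono hab) (h.1.mono hbc) (h.1.mono hcd)
  · exact mul_nonneg hK (by linarith)
  · rw [← Real.exp_add]; simp

theorem level_even {ρ : ℝ} (hρ : Irrational ρ) (h1 : ρ ∈ Ioo (0 : ℝ) 1) {n : ℕ} (hn : Even n) :
    Level ρ (qden ρ n) (qden ρ (n + 1)) (pnum ρ n) (pnum ρ (n + 1)) := by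
  have s0 := disp_sign hρ h1 n
  have s1 := disp_sign hρ h1 (n + 1)
  have lt := abs_disp_succ_lt hρ h1 n
  rw [hn.neg_one_pow, one_mul] at s0
  rw [hn.add_one.neg_one_pow] at s1
  have n1 : disp ρ (n + 1) < 0 := by linarith
  rw [abs_of_neg n1, abs_of_pos s0.1] at lt
  have hq := one_le_qden hρ n
  refine ⟨?_, ?_, ?_, ?_, hq.1, hq.2, fun l m h2 h3 => ?_⟩
  · simpa [disp] using s0.1
  · simpa [disp] using s0.2
  · simpa [disp] using n1
  · simp only [disp] at lt; push_cast; linarith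
  · have := abs_disp_le hρ h1 n l m h2 h3
    rw [abs_of_pos s0.1] at this
    simpa [disp] using this

theorem level_odd {ρ : ℝ} (hρ : Irrational ρ) (h1 : ρ ∈ Ioo (0 : ℝ) 1) {n : ℕ} (hn : Odd n) :
    Level (-ρ) (qden ρ n) (qden ρ (n + 1)) (-pnum ρ n) (-pnum ρ (n + 1)) := by
  have s0 := disp_sign hρ h1 n
  have s1 := disp_sign hρ h1 (n + 1)
  have lt := abs_disp_succ_lt hρ h1 n
  rw [hn.neg_one_pow] at s0
  rw [hn.add_one.neg_one_pow, one_mul] at s1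
  have n0 : disp ρ n < 0 := by linarith
  rw [abs_of_neg n0, abs_of_pos s1.1] at lt
  have hq := one_le_qden hρ n
  simp only [disp] at *
  refine ⟨?_, ?_, ?_, ?_, hq.1, hq.2, fun l m h2 h3 => ?_⟩
  · push_cast; linarith
  · push_cast; linarith
  · push_cast; linarith
  · push_cast; linarith
  · have := abs_disp_le hρ h1 n l (-m) h2 h3
    simp only [disp] at this
    rw [abs_of_neg n0, ← abs_neg] at this
    push_cast at this ⊢
    rw [show (l : ℝ) * -ρ - m = -(l * ρ - -(m : ℝ)) by ring]
    linarith

/-- The power law bounds at the critical point `c`. -/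
def PowerLaw (f : ℝ → ℝ) (c s k₁ k₂ : ℝ) : Prop :=
  ∀ x, |x - c| ≤ 1 → k₁ * |x - c| ^ s ≤ |f x - f c| ∧ |f x - f c| ≤ k₂ * |x - c| ^ s

theorem PowerLaw.refl {f : ℝ → ℝ} {c s k₁ k₂ : ℝ} (h : PowerLaw f c s k₁ k₂) :
    PowerLaw (refl f) (-c) s k₁ k₂ := by
  intro x hx
  have e : |x - -c| = |-x - c| := by rw [← abs_neg]; congr 1; ring
  have := h (-x) (by rwa [← e])
  have e2 : |MCircle.refl f x - MCircle.refl f (-c)| = |f (-x) - f c| := by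
    rw [← abs_neg]; simp only [MCircle.refl, neg_neg]; congr 1; ring
  rwa [e, e2]

/-- Adjacent fundamental arcs of the `q`-th iterate are comparable. -/
def AdjComparable (f : ℝ → ℝ) (q : ℕ) (p : ℤ) (N : ℝ) : Prop :=
  ∀ w, |ret f q p (ret f q p w) - ret f q p w| ≤ N * |ret f q p w - w| ∧
    |ret f q p (ret f q p w) - ret f q p w| ≤
      N * |ret f q p (ret f q p (ret f q p w)) - ret f q p (ret f q p w)|

theorem Reg.adjComparable {f : ℝ → ℝ} {ρ K A : ℝ} {C : Finset ℝ} {q q' : ℕ} {p p' : ℤ}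
    (h : Reg f ρ C K A) (hl : Level ρ q q' p p') : AdjComparable f q p (adjConst C K A) := by
  intro w
  have hp := fun x => sub_pos.2 (h.toDyn.lt_ret x hl.pos)
  rw [abs_of_pos (hp _), abs_of_pos (hp _), abs_of_pos (hp _)]
  exact h.adjacent_comparable hl w

theorem AdjComparable.refl {f : ℝ → ℝ} {q : ℕ} {p : ℤ} {N : ℝ} (h : AdjComparable f q p N) :
    AdjComparable (refl f) q (-p) N := by
  intro w
  have := h (-w)
  simp only [ret_refl, neg_neg]
  have e : ∀ a b : ℝ, |-a - -b| = |a - b| := fun a b => by rw [← abs_neg]; congr 1; ring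
  have e' : ∀ a b : ℝ, |-a - b| = |a - -b| := fun a b => by rw [← abs_neg]; congr 1; ring
  rwa [e, e, e']

theorem refl_refl (f : ℝ → ℝ) : refl (refl f) = f := by
  ext x; simp [refl]

theorem tendsto_slope_right {g : ℝ → ℝ} {g' x : ℝ} (hg : HasDerivAt g g' x) :
    Tendsto (fun y => (g y - g x) / (y - x)) (𝓝[>] x) (𝓝 g') := by
  have := (hasDerivAt_iff_tendsto_slope.1 hg).mono_left
    (nhdsWithin_mono x (s := Ioi x) fun y (hy : x < y) => hy.ne')
  simpa only [slope_fun_def_field] using this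

theorem tendsto_slope_left {g : ℝ → ℝ} {g' x : ℝ} (hg : HasDerivAt g g' x) :
    Tendsto (fun y => (g y - g x) / (y - x)) (𝓝[<] x) (𝓝 g') := by
  have := (hasDerivAt_iff_tendsto_slope.1 hg).mono_left
    (nhdsWithin_mono x (s := Iio x) fun y (hy : y < x) => hy.ne)
  simpa only [slope_fun_def_field] using this

/-- Cross-ratio distortion in the limit of a vanishing middle interval. -/
theorem CrossBound.deriv_middle {g : ℝ → ℝ} {g' δ a x d : ℝ} (hg : HasDerivAt g g' x)
    (hx : x < d) (h : ∀ y ∈ Ioo x d, CrossBound g δ a x y d) :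
    δ * ((g x - g a) * (g d - g x) * (d - a)) ≤ g' * (g d - g a) * ((x - a) * (d - x)) := by
  have hc : Tendsto g (𝓝[>] x) (𝓝 (g x)) := hg.continuousAt.continuousWithinAt
  have hid : Tendsto (fun y : ℝ => y) (𝓝[>] x) (𝓝 x) := tendsto_id.mono_left nhdsWithin_le_nhds
  refine le_of_tendsto_of_tendsto
    (((((hc.const_sub (g d)).const_mul (g x - g a)).mul_const (d - a))).const_mul δ)
    (((tendsto_slope_right hg).mul_const (g d - g a)).mul
      ((hid.const_sub d).const_mul (x - a))) ?_
  filter_upwards [Ioo_mem_nhdsGT hx] with y hy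
  have := h y hy
  have p : 0 < y - x := sub_pos.2 hy.1
  have p' : y - x ≠ 0 := p.ne'
  rw [CrossBound] at this
  rw [← sub_nonneg] at this ⊢
  refine nonneg_of_mul_nonneg_left (b := y - x) ?_ p
  refine this.trans_eq ?_
  field_simp

/-- Cross-ratio distortion in the limit of a vanishing left interval. -/
theorem CrossBound.deriv_left {g : ℝ → ℝ} {g' δ x c d w : ℝ} (hg : HasDerivAt g g' x)
    (hw : w < x) (h : ∀ y ∈ Ioo w x, CrossBound g δ y x c d) :
    δ * (g' * (g d - g c) * ((c - x) * (d - x))) ≤ (g c - g x) * (g d - g x) * (d - c) := by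
  have hc : Tendsto g (𝓝[<] x) (𝓝 (g x)) := hg.continuousAt.continuousWithinAt
  have hid : Tendsto (fun y : ℝ => y) (𝓝[<] x) (𝓝 x) := tendsto_id.mono_left nhdsWithin_le_nhds
  refine le_of_tendsto_of_tendsto
    (((((tendsto_slope_left hg).mul_const (g d - g c))).mul
      ((hid.const_sub d).const_mul (c - x))).const_mul δ)
    (((hc.const_sub (g d)).const_mul (g c - g x)).mul_const (d - c)) ?_
  filter_upwards [Ioo_mem_nhdsLT hw] with y hy
  have := h y hy
  have p : 0 < x - y := sub_pos.2 hy.2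
  have p' : y - x ≠ 0 := by linarith
  rw [CrossBound] at this
  rw [← sub_nonneg] at this ⊢
  refine nonneg_of_mul_nonneg_left (b := x - y) ?_ p
  refine this.trans_eq ?_
  field_simp
  ring

/-- `[b, c]` has definite space on both sides in the image of `[a, d]` under `g`, and `g` does
not contract cross-ratios much on `[a, d]`. -/
structure KoebeSpace (g : ℝ → ℝ) (δ τ a b c d : ℝ) : Prop where
  diff : Differentiable ℝ g
  mono : StrictMono g
  δ_pos : 0 < δ
  δ_le : δ ≤ 1
  τ_pos : 0 < τ
  τ_le : τ ≤ 1
  hab : a < b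
  hbc : b < c
  hcd : c < d
  left : τ * (g c - g b) ≤ g b - g a
  right : τ * (g c - g b) ≤ g d - g c
  cross : ∀ a' b' c' d', a ≤ a' → a' < b' → b' < c' → c' < d' → d' ≤ d →
    CrossBound g δ a' b' c' d'

namespace KoebeSpace

variable {g : ℝ → ℝ} {δ τ a b c d : ℝ}

theorem refl (h : KoebeSpace g δ τ a b c d) :
    KoebeSpace (refl g) δ τ (-d) (-c) (-b) (-a) where
  diff := (h.diff.comp differentiable_neg).neg
  mono x y hxy := neg_lt_neg (h.mono (neg_lt_neg hxy))
  δ_pos := h.δ_pos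
  δ_le := h.δ_le
  τ_pos := h.τ_pos
  τ_le := h.τ_le
  hab := neg_lt_neg h.hcd
  hbc := neg_lt_neg h.hbc
  hcd := neg_lt_neg h.hab
  left := by have := h.right; simp only [MCircle.refl, neg_neg]; linarith
  right := by have := h.left; simp only [MCircle.refl, neg_neg]; linarith
  cross a' b' c' d' h1 h2 h3 h4 h5 :=
    (h.cross _ _ _ _ (by linarith) (neg_lt_neg h4) (neg_lt_neg h3) (neg_lt_neg h2)
      (by linarith)).refl

theorem deriv_le_of_left (h : KoebeSpace g δ τ a b c d) {x : ℝ} (hb : b ≤ x)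
    (hx : c - b ≤ 2 * (c - x)) :
    δ * τ * (deriv g x * (c - b)) ≤ 4 * (g c - g b) := by
  have hbc := h.hbc
  have hcd := h.hcd
  have hab := h.hab
  have hxc : x < c := by linarith
  have key := CrossBound.deriv_left (h.diff x).hasDerivAt (lt_of_lt_of_le hab hb)
    fun y hy => h.cross y x c d hy.1.le hy.2 hxc hcd le_rfl
  have g1 := h.mono hxc
  have g2 := h.mono.monotone hb
  have g3 := h.mono hcd
  have hd := h.mono.monotone.deriv_nonneg (x := x)
  have hr := h.right
  have τ0 := h.τ_pos
  have τ1 := h.τ_le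
  have δ0 := h.δ_pos
  set D := deriv g x
  have p : 0 < (g d - g c) * (d - x) := mul_pos (by linarith) (by linarith)
  refine le_of_mul_le_mul_right ?_ p
  have e1 : τ * (g d - g x) ≤ 2 * (g d - g c) := by
    nlinarith [mul_le_mul_of_nonneg_right τ1 (sub_nonneg.2 g3.le)]
  calc δ * τ * (D * (c - b)) * ((g d - g c) * (d - x))
      = δ * τ * D * ((g d - g c) * (d - x)) * (c - b) := by ring
    _ ≤ δ * τ * D * ((g d - g c) * (d - x)) * (2 * (c - x)) :=
        mul_le_mul_of_nonneg_left hx (by positivity)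
    _ = 2 * τ * (δ * (D * (g d - g c) * ((c - x) * (d - x)))) := by ring
    _ ≤ 2 * τ * ((g c - g x) * (g d - g x) * (d - c)) :=
        mul_le_mul_of_nonneg_left key (by positivity)
    _ = 2 * ((g c - g x) * (d - c)) * (τ * (g d - g x)) := by ring
    _ ≤ 2 * ((g c - g x) * (d - c)) * (2 * (g d - g c)) := mul_le_mul_of_nonneg_left e1
        (mul_nonneg zero_le_two (mul_nonneg (by linarith) (by linarith)))
    _ = 4 * (g d - g c) * ((g c - g x) * (d - c)) := by ring
    _ ≤ 4 * (g d - g c) * ((g c - g b) * (d - x)) := by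
        refine mul_le_mul_of_nonneg_left ?_ (by linarith)
        exact mul_le_mul (by linarith) (by linarith) (by linarith) (by linarith)
    _ = _ := by ring

theorem deriv_le (h : KoebeSpace g δ τ a b c d) {x : ℝ} (hb : b ≤ x) (hc : x ≤ c) :
    δ * τ * (deriv g x * (c - b)) ≤ 4 * (g c - g b) := by
  rcases le_total (c - b) (2 * (c - x)) with hx | hx
  · exact h.deriv_le_of_left hb hx
  · have := h.refl.deriv_le_of_left (x := -x) (by linarith) (by linarith)
    have e : deriv (MCircle.refl g) (-x) = deriv g x := by
      change deriv (fun y => -g (-y)) (-x) = _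
      rw [deriv.fun_neg, deriv_comp_neg, neg_neg, neg_neg]
    rw [e] at this
    simp only [MCircle.refl, neg_neg] at this
    linarith

/-- Shrinking the right space to be no longer than the middle interval. -/
theorem exists_right (h : KoebeSpace g δ τ a b c d) :
    ∃ d₁, c < d₁ ∧ d₁ ≤ d ∧ d₁ - c ≤ c - b ∧ δ * τ / 3 * (g c - g b) ≤ g d₁ - g c := by
  have hbc := h.hbc
  have hcd := h.hcd
  have hr := h.right
  have τ0 := h.τ_pos
  have τ1 := h.τ_le
  have δ0 := h.δ_pos
  have δ1 := h.δ_le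
  have g1 := h.mono hbc
  have g2 := h.mono hcd
  have le : δ * τ / 3 ≤ τ := by nlinarith
  rcases le_or_gt (d - c) (c - b) with hx | hx
  · refine ⟨d, hcd, le_rfl, hx, le_trans ?_ hr⟩
    exact mul_le_mul_of_nonneg_right le (by linarith)
  · refine ⟨c + (c - b), by linarith, by linarith, by linarith, ?_⟩
    set d₁ := c + (c - b) with hd₁
    have key := h.cross b c d₁ d h.hab.le hbc (by linarith) (by linarith) le_rfl
    rw [CrossBound] at key
    have g3 := h.mono (show c < d₁ by linarith)
    have g4 := h.mono (show d₁ < d by linarith)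
    rw [show d₁ - c = c - b by rw [hd₁]; ring] at key
    have k2 : δ * ((g c - g b) * (g d - g d₁)) ≤ (g d₁ - g c) * (g d - g b) := by
      have p : 0 < (c - b) * (d - b) := mul_pos (by linarith) (by linarith)
      refine le_of_mul_le_mul_right ?_ p
      calc _ = δ * ((g c - g b) * (g d - g d₁) * ((c - b) * (d - b))) := by ring
        _ ≤ _ := key
        _ ≤ (g d₁ - g c) * (g d - g b) * ((c - b) * (d - b)) :=
          mul_le_mul_of_nonneg_left (mul_le_mul_of_nonneg_left (by linarith) (by linarith))
            (mul_nonneg (by linarith) (by linarith))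
    set J := g c - g b
    set R := g d - g c with hR
    set S := g d₁ - g c with hS
    have J0 : 0 < J := by simp only [J]; linarith
    have R0 : 0 < R := by linarith
    have S0 : 0 < S := by linarith
    rw [show g d - g d₁ = R - S by simp [R, S], show g d - g b = R + J by simp [R, J]] at k2
    have k3 : δ * J * R ≤ S * (R + 2 * J) := by nlinarith [mul_pos J0 S0]
    have k4 : τ * (R + 2 * J) ≤ 3 * R := by nlinarith
    refine le_of_mul_le_mul_right ?_ R0
    nlinarith

theorem le_deriv (h : KoebeSpace g δ τ a b c d) {x : ℝ} (hb : b ≤ x) (hc : x ≤ c) :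
    δ ^ 2 * τ * (g c - g b) ≤ 12 * (deriv g x * (c - b)) := by
  obtain ⟨d₁, h1, h2, h3, h4⟩ := h.exists_right
  have hbc := h.hbc
  have hab := h.hab
  have τ0 := h.τ_pos
  have δ0 := h.δ_pos
  have key := CrossBound.deriv_middle (a := a) (d := d₁) (h.diff x).hasDerivAt (by linarith)
    fun y hy => h.cross a x y d₁ le_rfl (by linarith) hy.1 hy.2 h2
  have hl := h.left
  have g1 := h.mono.monotone hb
  have g2 := h.mono.monotone hc
  have g3 := h.mono hab
  have g4 := h.mono hbc
  have g5 := h.mono h1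
  have hd := h.mono.monotone.deriv_nonneg (x := x)
  set D := deriv g x
  have le : δ * τ / 3 ≤ τ := by nlinarith [h.δ_le]
  set J := g c - g b
  have J0 : 0 < J := by simp only [J]; linarith
  set σ := δ * τ / 3 with hσ
  have a1 : σ * J ≤ g x - g a := by
    have := mul_le_mul_of_nonneg_right le J0.le
    linarith
  have a2 : σ * J ≤ g d₁ - g x := by linarith
  set P := g x - g a with hP
  set Q := g d₁ - g x with hQ
  have σJ : 0 < σ * J := by positivity
  rw [show g d₁ - g a = P + Q by simp [P, Q]] at key
  have b1 : (P + Q) * (σ * J) ≤ 2 * (P * Q) := by nlinarith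
  have p : 0 < (P + Q) * (d₁ - a) := mul_pos (by linarith) (by linarith)
  have b2 : (x - a) * (d₁ - x) ≤ (d₁ - a) * (2 * (c - b)) :=
    mul_le_mul (by linarith) (by linarith) (by linarith) (by linarith)
  refine le_of_mul_le_mul_right ?_ p
  calc δ ^ 2 * τ * J * ((P + Q) * (d₁ - a))
      = 3 * δ * (d₁ - a) * ((P + Q) * (σ * J)) := by rw [hσ]; ring
    _ ≤ 3 * δ * (d₁ - a) * (2 * (P * Q)) := mul_le_mul_of_nonneg_left b1
        (mul_nonneg (by positivity) (by linarith))
    _ = 6 * (δ * (P * Q * (d₁ - a))) := by ring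
    _ ≤ 6 * (D * (P + Q) * ((x - a) * (d₁ - x))) := mul_le_mul_of_nonneg_left key (by norm_num)
    _ ≤ 6 * (D * (P + Q) * ((d₁ - a) * (2 * (c - b)))) := by
        refine mul_le_mul_of_nonneg_left (mul_le_mul_of_nonneg_left b2 ?_) (by norm_num)
        exact mul_nonneg hd (by linarith)
    _ = _ := by ring

/-- **Koebe distortion principle**: with definite space, the derivative is comparable to the
average slope. -/
theorem deriv_comparable (h : KoebeSpace g δ τ a b c d) {x : ℝ} (hb : b ≤ x) (hc : x ≤ c) :
    (12 / (δ ^ 2 * τ))⁻¹ * ((g c - g b) / (c - b)) ≤ deriv g x ∧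
      deriv g x ≤ 12 / (δ ^ 2 * τ) * ((g c - g b) / (c - b)) := by
  have h1 := h.le_deriv hb hc
  have h2 := h.deriv_le hb hc
  have τ0 := h.τ_pos
  have δ0 := h.δ_pos
  have p : 0 < c - b := sub_pos.2 h.hbc
  have hd := h.mono.monotone.deriv_nonneg (x := x)
  have g0 := sub_pos.2 (h.mono h.hbc)
  constructor
  · rw [inv_div, div_mul_div_comm, div_le_iff₀ (by positivity)]
    linarith
  · rw [div_mul_div_comm, le_div_iff₀ (by positivity)]
    have := mul_le_mul_of_nonneg_right h.δ_le
      (show 0 ≤ δ * τ * (deriv g x * (c - b)) by positivity)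
    nlinarith

end KoebeSpace

namespace Dyn

variable {f : ℝ → ℝ} {ρ : ℝ} {q q' : ℕ} {p p' : ℤ}

theorem le_ret_cube (h : Dyn f ρ) (hl : Level ρ q q' p p') (c : ℝ) :
    ret f q p (ret f q p c) ≤ ret f q p (ret f q p (ret f q p (ret f q' p' c))) := by
  have : c < ret f q p (ret f q' p' c) := by
    rw [h.ret_ret]
    refine h.lt_ret c ?_
    have := hl.sum_pos
    push_cast; linarith
  exact (h.strictMono_ret q p (h.strictMono_ret q p this)).le

theorem length_le (h : Dyn f ρ) (hl : Level ρ q q' p p') (c : ℝ) (j : ℕ) :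
    f^[j] (ret f q p (ret f q p c)) - f^[j] (ret f q' p' c) ≤ 4 := by
  have h1 := (h.mono.iterate j).monotone (h.le_ret_cube hl c)
  have h2 : ∀ x, f^[j] (ret f q p x) < f^[j] x + 1 := fun x => by
    rw [h.iterate_ret]; exact h.ret_lt_add_one _ hl.lt_one
  have := h2 (ret f q' p' c)
  have := h2 (ret f q p (ret f q' p' c))
  have := h2 (ret f q p (ret f q p (ret f q' p' c)))
  linarith

theorem sum_length_le_six (h : Dyn f ρ) (hl : Level ρ q q' p p') (c : ℝ) :
    ∑ j ∈ Finset.range q', (f^[j] (ret f q p (ret f q p c)) - f^[j] (ret f q' p' c)) ≤ 6 := by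
  have h1 := h.sum_length_le hl (ret f q' p' c)
  have h2 := h.sum_length_le hl (ret f q p (ret f q' p' c))
  have h3 := h.sum_length_le hl (ret f q p (ret f q p (ret f q' p' c)))
  calc _ ≤ _ := Finset.sum_le_sum fun j _ =>
        sub_le_sub_right ((h.mono.iterate j).monotone (h.le_ret_cube hl c)) _
    _ ≤ 2 + 2 + 2 := by
        refine le_trans (le_of_eq ?_) (add_le_add (add_le_add h1 h2) h3)
        rw [← Finset.sum_add_distrib, ← Finset.sum_add_distrib]
        exact Finset.sum_congr rfl fun j _ => by ring
    _ = 6 := by norm_num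

end Dyn

theorem SmoothReg.crossBound_iterate {f : ℝ → ℝ} {ρ K A : ℝ} {C : Finset ℝ}
    (h : SmoothReg f ρ C K A) {a b c d : ℝ} (hab : a < b) (hbc : b < c) (hcd : c < d) {k : ℕ}
    (hlen : ∀ j < k, f^[j] d - f^[j] a ≤ 4)
    (hC : ∀ j < k, ∀ t ∈ Icc (f^[j] a) (f^[j] d), t ∉ critSet C) :
    CrossBound f^[k] (Real.exp (-(K * ∑ j ∈ Finset.range k, (f^[j] d - f^[j] a)))) a b c d := by
  have D := h.toDyn
  induction k with
  | zero => simp [CrossBound]; linarith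
  | succ k ih =>
    have h1 := ih (fun j hj => hlen j (by omega)) fun j hj => hC j (by omega)
    have g1 := D.iterate_lt k hab
    have g2 := D.iterate_lt k hbc
    have g3 := D.iterate_lt k hcd
    rw [Function.iterate_succ', Finset.sum_range_succ, mul_add, neg_add_rev, Real.exp_add]
    exact h1.comp (h.cross _ _ _ _ g1 g2 g3 (hlen k (by omega)) (hC k (by omega)))
      (Real.exp_pos _).le hab hcd g1 g3 (h.mono g1) (h.mono g3)

/-- The space constant of `space_le`, normalized to be at most one. -/
def branchSpace (C : Finset ℝ) (K A s k₁ k₂ : ℝ) : ℝ := min 1 (spaceConst C K A s k₁ k₂)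

/-- The distortion constant of the regular branches. -/
def branchConst (C : Finset ℝ) (K A s k₁ k₂ : ℝ) : ℝ :=
  12 / (Real.exp (-(K * 6)) ^ 2 * branchSpace C K A s k₁ k₂)

theorem branchConst_image_neg (C : Finset ℝ) (K A s k₁ k₂ : ℝ) :
    branchConst (C.image Neg.neg) K A s k₁ k₂ = branchConst C K A s k₁ k₂ := by
  simp only [branchConst, branchSpace, spaceConst, adjConst, returnDist, card_image_neg]

theorem adjConst_image_neg (C : Finset ℝ) (K A : ℝ) :
    adjConst (C.image Neg.neg) K A = adjConst C K A := by
  simp only [adjConst, returnDist, card_image_neg]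

theorem Reg.one_lt_branchConst {f : ℝ → ℝ} {ρ K A : ℝ} {C : Finset ℝ} (h : Reg f ρ C K A)
    {s k₁ k₂ : ℝ} (hk₁ : 0 < k₁) (hk₂ : 0 < k₂) : 1 < branchConst C K A s k₁ k₂ := by
  have h1 : Real.exp (-(K * 6)) ≤ 1 := Real.exp_le_one_iff.2 (by linarith [h.K_nonneg])
  have h2 := pow_le_one₀ (n := 2) (Real.exp_pos (-(K * 6))).le h1
  have h3 : 0 < branchSpace C K A s k₁ k₂ := lt_min one_pos (h.spaceConst_pos hk₁ hk₂)
  have h4 : branchSpace C K A s k₁ k₂ ≤ 1 := min_le_left _ _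
  rw [branchConst, lt_div_iff₀ (by positivity)]
  have := mul_le_one₀ h2 h3.le h4
  linarith

/-- Distortion of the iterates `f^[k]` on the `i`-th image of the arc from `c` to its first
return, as long as no critical point is met on a neighbourhood. -/
def BranchBound (f : ℝ → ℝ) (q q' : ℕ) (p p' : ℤ) (c : ℝ) (C : Finset ℝ) (B : ℝ) : Prop :=
  ∀ i k, i + k ≤ q' →
    (∀ j, i ≤ j → j < i + k →
      ∀ t ∈ uIcc (f^[j] (ret f q' p' c)) (f^[j] (ret f q p (ret f q p c))), t ∉ critSet C) →
    ∀ x ∈ uIcc (f^[i] c) (f^[i] (ret f q p c)),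
      B⁻¹ * (|f^[i + k] (ret f q p c) - f^[i + k] c| / |f^[i] (ret f q p c) - f^[i] c|) ≤
          deriv f^[k] x ∧
        deriv f^[k] x ≤
          B * (|f^[i + k] (ret f q p c) - f^[i + k] c| / |f^[i] (ret f q p c) - f^[i] c|)

theorem deriv_refl (g : ℝ → ℝ) (x : ℝ) : deriv (fun y => -g (-y)) x = deriv g (-x) := by
  rw [deriv.fun_neg, deriv_comp_neg, neg_neg]

theorem neg_mem_uIcc_neg {a b x : ℝ} (h : x ∈ uIcc a b) : -x ∈ uIcc (-a) (-b) := by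
  rw [mem_uIcc] at *
  rcases h with h | h
  · exact Or.inr ⟨by linarith, by linarith⟩
  · exact Or.inl ⟨by linarith, by linarith⟩

theorem BranchBound.of_refl {f : ℝ → ℝ} {q q' : ℕ} {p p' : ℤ} {c : ℝ} {C : Finset ℝ} {B : ℝ}
    (h : BranchBound (refl f) q q' (-p) (-p') (-c) (C.image Neg.neg) B) :
    BranchBound f q q' p p' c C B := by
  intro i k hik hC x hx
  have hr : ∀ k, (MCircle.refl f)^[k] = fun y => -f^[k] (-y) :=
    fun k => funext (refl_iterate f k)
  have e : ∀ a b : ℝ, |-a - -b| = |a - b| := fun a b => by rw [← abs_neg]; congr 1; ring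
  have := h i k hik (fun j h1 h2 t ht ht' => hC j h1 h2 (-t) ?_ (mem_critSet_image_neg.1 ht'))
    (-x) ?_
  · simpa only [ret_refl, hr, neg_neg, deriv_refl, e] using this
  · have := neg_mem_uIcc_neg ht
    simpa only [ret_refl, hr, neg_neg] using this
  · have := neg_mem_uIcc_neg hx
    simpa only [ret_refl, hr, neg_neg] using this

theorem SmoothReg.branchBound {f : ℝ → ℝ} {ρ K A : ℝ} {C : Finset ℝ} {q q' : ℕ} {p p' : ℤ}
    (h : SmoothReg f ρ C K A) (hl : Level ρ q q' p p')
    (hG' : AdjComparable f q' p' (adjConst C K A)) {c s k₁ k₂ : ℝ} (hs : 1 < s) (hk₁ : 0 < k₁)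
    (hk₂ : 0 < k₂) (hc : PowerLaw f c s k₁ k₂) :
    BranchBound f q q' p p' c C (branchConst C K A s k₁ k₂) := by
  intro i k hik hC x hx
  have D := h.toDyn
  have l1 : ret f q' p' c < c := D.ret_lt c hl.neg
  have l2 : c < ret f q p c := D.lt_ret c hl.pos
  have l3 : ret f q p c < ret f q p (ret f q p c) := D.lt_ret _ hl.pos
  have mi := fun {x y : ℝ} (hxy : x < y) (j : ℕ) => D.iterate_lt j hxy
  have hτ := h.toReg.spaceConst_pos (s := s) hk₁ hk₂
  have sp := h.toReg.space_le hl hG' hs hk₁ hk₂ hc hik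
  have it : ∀ y, f^[k] (f^[i] y) = f^[i + k] y := fun y => by
    rw [add_comm, Function.iterate_add_apply]
  have it' : ∀ j y, f^[j] (f^[i] y) = f^[i + j] y := fun j y => by
    rw [add_comm, Function.iterate_add_apply]
  have J0 := sub_pos.2 (mi l2 (i + k))
  have τle := mul_le_mul_of_nonneg_right
    (min_le_right 1 (spaceConst C K A s k₁ k₂)) J0.le
  have ks : KoebeSpace f^[k] (Real.exp (-(K * 6))) (branchSpace C K A s k₁ k₂)
      (f^[i] (ret f q' p' c)) (f^[i] c) (f^[i] (ret f q p c))
      (f^[i] (ret f q p (ret f q p c))) :=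
    { diff := h.diff.iterate k
      mono := h.mono.iterate k
      δ_pos := Real.exp_pos _
      δ_le := Real.exp_le_one_iff.2 (by linarith [h.K_nonneg])
      τ_pos := lt_min one_pos hτ
      τ_le := min_le_left _ _
      hab := mi l1 i
      hbc := mi l2 i
      hcd := mi l3 i
      left := by
        rw [it, it, it]
        exact τle.trans sp.1
      right := by
        rw [it, it, it]
        exact τle.trans sp.2
      cross := by
        intro a' b' c' d' ha hab hbc hcd hd
        have hsub : ∀ j, f^[i + j] (ret f q' p' c) ≤ f^[j] a' ∧
            f^[j] d' ≤ f^[i + j] (ret f q p (ret f q p c)) := fun j => by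
          rw [← it', ← it']
          exact ⟨(D.mono.iterate j).monotone ha, (D.mono.iterate j).monotone hd⟩
        refine (h.crossBound_iterate hab hbc hcd (k := k) (fun j _ => ?_)
          fun j hj t ht => ?_).mono ?_ hab hbc hcd (mi hab k) (mi hcd k)
        · have := D.length_le hl c (i + j)
          linarith [hsub j]
        · refine hC (i + j) (by omega) (by omega) t ?_
          rw [uIcc_of_le (mi (l1.trans (l2.trans l3)) _).le]
          exact ⟨(hsub j).1.trans ht.1, ht.2.trans (hsub j).2⟩
        · refine Real.exp_le_exp.2 (neg_le_neg (mul_le_mul_of_nonneg_left ?_ h.K_nonneg))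
          refine le_trans ?_ (D.sum_length_le_six hl c)
          calc _ ≤ ∑ j ∈ Finset.range k, (f^[i + j] (ret f q p (ret f q p c)) -
                f^[i + j] (ret f q' p' c)) :=
                Finset.sum_le_sum fun j _ => sub_le_sub (hsub j).2 (hsub j).1
            _ = ∑ j ∈ Finset.Ico i (i + k), (f^[j] (ret f q p (ret f q p c)) -
                f^[j] (ret f q' p' c)) := by
                rw [Finset.sum_Ico_eq_sum_range]; simp
            _ ≤ _ := by
                refine Finset.sum_le_sum_of_subset_of_nonneg (fun j hj => ?_) fun j _ _ =>
                  (sub_pos.2 (mi (l1.trans (l2.trans l3)) _)).le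
                rw [Finset.mem_Ico] at hj
                exact Finset.mem_range.2 (by omega) }
  rw [uIcc_of_le (mi l2 i).le] at hx
  have := ks.deriv_comparable hx.1 hx.2
  rw [it, it] at this
  rwa [abs_of_pos J0, abs_of_pos (sub_pos.2 (mi l2 i))]

theorem GoodMap.exists_branchBound {f dc : ℝ → ℝ} {C : Finset ℝ} {ρ c₀ : ℝ}
    (hf : GoodMap f C dc ρ) (hc₀ : c₀ ∈ C) :
    ∃ B, 1 < B ∧ ∀ n,
      BranchBound f (qden ρ n) (qden ρ (n + 1)) (pnum ρ n) (pnum ρ (n + 1)) c₀ C B := by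
  obtain ⟨hm, hr, hρ, h1⟩ := hf
  obtain ⟨K, A, h⟩ := hm.exists_smoothReg hr hρ
  obtain ⟨s, k₁, k₂, hs, hk₁, hk₂, hc⟩ := hm.exists_powerLaw hc₀
  refine ⟨branchConst C K A s k₁ k₂, h.toReg.one_lt_branchConst hk₁ hk₂, fun n => ?_⟩
  have adj : ∀ n, AdjComparable f (qden ρ n) (pnum ρ n) (adjConst C K A) := by
    intro n
    rcases Nat.even_or_odd n with hn | hn
    · exact h.toReg.adjComparable (level_even hρ h1 hn)
    · have := (h.refl.toReg.adjComparable (level_odd hρ h1 hn)).refl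
      rwa [refl_refl, neg_neg, adjConst_image_neg] at this
  rcases Nat.even_or_odd n with hn | hn
  · exact h.branchBound (level_even hρ h1 hn) (adj (n + 1)) hs hk₁ hk₂ hc
  · refine BranchBound.of_refl ?_
    rw [← branchConst_image_neg]
    refine h.refl.branchBound (level_odd hρ h1 hn) ?_ hs hk₁ hk₂ (PowerLaw.refl hc)
    rw [adjConst_image_neg]
    exact (adj (n + 1)).refl

theorem uIcc_subset_image_of_strictMono {g : ℝ → ℝ} (hg : StrictMono g)
    (hs : Function.Surjective g) (a b : ℝ) : uIcc (g a) (g b) ⊆ g '' uIcc a b := by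
  intro y hy
  obtain ⟨x, rfl⟩ := hs y
  refine ⟨x, ?_, rfl⟩
  simpa only [mem_uIcc, hg.le_iff_le] using hy

theorem retPt_eq_ret (f : ℝ → ℝ) (ρ x : ℝ) (n : ℕ) :
    retPt f ρ x n = ret f (qden ρ n) (pnum ρ n) x := by
  simp [retPt, ret]

theorem Dyn.uIcc_subset_image_Tset {f : ℝ → ℝ} {ρ : ℝ} (h : Dyn f ρ) (x : ℝ) (n j : ℕ) :
    uIcc (f^[j] (ret f (qden ρ (n + 1)) (pnum ρ (n + 1)) x))
      (f^[j] (ret f (qden ρ n) (pnum ρ n) (ret f (qden ρ n) (pnum ρ n) x))) ⊆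
    f^[j] '' Tset f ρ x n := by
  refine (uIcc_subset_image_of_strictMono (h.mono.iterate j) (h.surj_iterate j) _ _).trans
    (image_mono ?_)
  rw [Tset, arcI, arcI, retPt_eq_ret, retPt_eq_ret]
  refine (uIcc_subset_uIcc_union_uIcc (b := ret f (qden ρ n) (pnum ρ n) x)).trans
    (union_subset_union ?_ ?_)
  · rw [uIcc_comm x]
    exact uIcc_subset_uIcc_union_uIcc
  · have := uIcc_subset_image_of_strictMono (h.strictMono_ret (qden ρ n) (pnum ρ n))
      (h.surj_ret _ _) x (ret f (qden ρ n) (pnum ρ n) x)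
    have e : ret f (qden ρ n) (pnum ρ n) = fun z => f^[qden ρ n] z - (pnum ρ n : ℝ) :=
      funext fun z => by simp [ret]
    rwa [e] at this ⊢

end MCircle

/-- **Regular branches between consecutive critical times** (Fact 3.7). For a
multicritical circle map `f` with irrational rotation number, fixed critical point
`c₀` and `Tₙ = I_{n+1} ∪ Iₙ ∪ f^{qₙ}(Iₙ)`, there are `K₀ = K₀(f) > 1` and
`n₀ = n₀(f)` such that for all `n ≥ n₀`: if `1 ≤ j₁ < j₂ ≤ q_{n+1}` are two
consecutive critical times (i.e. `f^{j₁}(Tₙ)` and `f^{j₂}(Tₙ)` contain critical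
points, and no `f^j(Tₙ)` with `j₁ < j < j₂` does), then for every
`x ∈ f^{j₁+1}(Iₙ)`,
`K₀⁻¹ |f^{j₂}(Iₙ)|/|f^{j₁+1}(Iₙ)| ≤ Df^{j₂-j₁-1}(x) ≤ K₀ |f^{j₂}(Iₙ)|/|f^{j₁+1}(Iₙ)|`. -/
theorem regular_branches (f : ℝ → ℝ) (C : Finset ℝ) (dc : ℝ → ℝ) (ρ c₀ : ℝ)
    (hf : GoodMap f C dc ρ) (hc₀ : c₀ ∈ C) :
    ∃ K₀ : ℝ, 1 < K₀ ∧ ∃ n₀ : ℕ, ∀ n ≥ n₀, ∀ j₁ j₂ : ℕ,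
      1 ≤ j₁ → j₁ < j₂ → j₂ ≤ qden ρ (n + 1) →
      IsCritTime f ρ c₀ C n j₁ → IsCritTime f ρ c₀ C n j₂ →
      (∀ j : ℕ, j₁ < j → j < j₂ → ¬ IsCritTime f ρ c₀ C n j) →
      ∀ x ∈ f^[j₁ + 1] '' arcI f ρ c₀ n,
        K₀⁻¹ * (arcImgLen f ρ c₀ n j₂ / arcImgLen f ρ c₀ n (j₁ + 1)) ≤
            deriv (f^[j₂ - j₁ - 1]) x ∧
        deriv (f^[j₂ - j₁ - 1]) x ≤
            K₀ * (arcImgLen f ρ c₀ n j₂ / arcImgLen f ρ c₀ n (j₁ + 1)) := by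
  obtain ⟨B, hB, h⟩ := hf.exists_branchBound hc₀
  have D := hf.1.1.dyn hf.2.1 hf.2.2.1
  refine ⟨B, hB, 0, fun n _ j₁ j₂ _ h12 hj₂ _ _ hcrit x hx => ?_⟩
  obtain ⟨y, hy, rfl⟩ := hx
  have e : j₁ + 1 + (j₂ - j₁ - 1) = j₂ := by omega
  rw [arcI, retPt_eq_ret] at hy
  have := h n (j₁ + 1) (j₂ - j₁ - 1) (by omega) (fun j h1 h2 t ht ⟨c, hc, m, htm⟩ =>
      hcrit j (by omega) (by omega) ⟨c, hc, m, ?_⟩) (f^[j₁ + 1] y) ?_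
  · rwa [e, ← retPt_eq_ret] at this
  · rw [← htm]
    exact D.uIcc_subset_image_Tset c₀ n j ht
  · simpa only [mem_uIcc, (D.mono.iterate (j₁ + 1)).le_iff_le] using hy
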